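/- arXiv:2603.16283 — 8 statements merged into one kernel-verified Lean document; each statement's English description precedes it below -/
import Mathlib

section
/- Assume the leading coefficient of f, viewed as a polynomial in x₂ with coefficients in ℝ[x₁], is a nonzero constant. Let K ⊂ ℝ be an open interval such that for every k ∈ {1,…,d₂} there is no point (x,y) ∈ ℝ² with x ∈ K, f(x,y) = 0 and f^{(k)}(x,y) = 0. If C and C′ are connected components of Z_ℝ(f) ∩ π₁⁻¹(K) such that for every k ∈ {1,…,d₂} the (constant, nonzero) sign of f^{(k)} on C equals the sign of f^{(k)} on C′, then C = C′. In other words, each connected component of Z_ℝ(f) ∩ π₁⁻¹(K) is uniquely identified by its sign sequence (sign(f^{(1)}),…,sign(f^{(d₂)})). -/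
/-- Evaluation of a bivariate polynomial `f ∈ (ℝ[x₁])[x₂]` at a point `(x, y) ∈ ℝ²`:
the outer variable is `x₂`, the coefficients live in `ℝ[x₁]`. -/
noncomputable def evXY (f : Polynomial (Polynomial ℝ)) (p : ℝ × ℝ) : ℝ :=
  Polynomial.eval p.2 (Polynomial.map (Polynomial.evalRingHom p.1) f)

/-- The `k`-th partial derivative with respect to `x₂`. -/
noncomputable def dX2 (k : ℕ) (f : Polynomial (Polynomial ℝ)) : Polynomial (Polynomial ℝ) :=
  (⇑(Polynomial.derivative (R := Polynomial ℝ)))^[k] f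


theorem evXY_continuous (f : Polynomial (Polynomial ℝ)) : Continuous (evXY f) := by
  have h : evXY f = fun p : ℝ × ℝ =>
      ∑ i ∈ Finset.range (f.natDegree + 1), (f.coeff i).eval p.1 * p.2 ^ i := by
    funext p
    unfold evXY
    rw [Polynomial.eval_map, Polynomial.eval₂_eq_sum_range]
    simp
  rw [h]
  refine continuous_finsetSum _ fun i _ => ?_
  exact ((f.coeff i).continuous.comp continuous_fst).mul (continuous_snd.pow i)

theorem evXY_dX2 (f : Polynomial (Polynomial ℝ)) (k : ℕ) (x y : ℝ) :
    evXY (dX2 k f) (x, y) = Polynomial.eval y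
      ((⇑(Polynomial.derivative (R := ℝ)))^[k] (f.map (Polynomial.evalRingHom x))) := by
  unfold evXY dX2
  rw [Polynomial.iterate_derivative_map]

/-- A polynomial whose derivative has constant sign on a segment is strictly monotone there. -/
theorem strict_of_deriv_sign (g : Polynomial ℝ) (u v : ℝ) (s : ℝ)
    (h : ∀ t ∈ Set.Icc u v, 0 < g.derivative.eval t * s) :
    StrictMonoOn (fun t => g.eval t) (Set.Icc u v) ∨
      StrictAntiOn (fun t => g.eval t) (Set.Icc u v) := by
  rcases lt_trichotomy s 0 with hs | hs | hs
  · right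
    refine strictAntiOn_of_deriv_neg (convex_Icc u v) g.continuous.continuousOn ?_
    intro x hx
    rw [Polynomial.deriv]
    have := h x (interior_subset hx)
    by_contra hc
    nlinarith
  · by_cases huv : (Set.Icc u v).Nonempty
    · obtain ⟨t, ht⟩ := huv
      have := h t ht
      simp [hs] at this
    · left
      intro x hx
      exact absurd ⟨x, hx⟩ huv
  · left
    refine strictMonoOn_of_deriv_pos (convex_Icc u v) g.continuous.continuousOn ?_
    intro x hx
    rw [Polynomial.deriv]
    have := h x (interior_subset hx)
    by_contra hc
    nlinarith

/-- Thom's lemma on a segment. -/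
theorem thom_segment (n : ℕ) : ∀ (P : Polynomial ℝ) (y z : ℝ), y ≤ z → P.natDegree ≤ n →
    (∀ k ≤ n, 0 < ((⇑(Polynomial.derivative (R := ℝ)))^[k] P).eval y *
      ((⇑(Polynomial.derivative (R := ℝ)))^[k] P).eval z) →
    ∀ t ∈ Set.Icc y z, 0 < P.eval t * P.eval y := by
  induction n with
  | zero =>
    intro P y z hyz hd h t ht
    have h0 := h 0 le_rfl
    obtain ⟨c, rfl⟩ : ∃ c, P = Polynomial.C c :=
      ⟨_, Polynomial.eq_C_of_natDegree_le_zero hd⟩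
    simpa using h0
  | succ n ih =>
    intro P y z hyz hd h t ht
    have h0 := h 0 (Nat.zero_le _)
    simp only [Function.iterate_zero, id_eq] at h0
    have h1 := ih P.derivative y z hyz
      ((Polynomial.natDegree_derivative_le P).trans (by omega))
      (fun k hk => by
        have := h (k + 1) (by omega)
        rwa [Function.iterate_succ_apply] at this)
    have hy : y ∈ Set.Icc y z := ⟨le_rfl, hyz⟩
    have hz : z ∈ Set.Icc y z := ⟨hyz, le_rfl⟩
    rcases strict_of_deriv_sign P y z _ h1 with hm | hm
    · have a1 := hm.monotoneOn hy ht ht.1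
      have a2 := hm.monotoneOn ht hz ht.2
      rcases lt_or_ge (P.eval y) 0 with hs | hs
      · have : P.eval z < 0 := by by_contra hc; nlinarith
        nlinarith
      · have : 0 < P.eval y := lt_of_le_of_ne hs (fun e => by simp [← e] at h0)
        nlinarith
    · have a1 := hm.antitoneOn hy ht ht.1
      have a2 := hm.antitoneOn ht hz ht.2
      rcases lt_or_ge (P.eval y) 0 with hs | hs
      · nlinarith
      · have : 0 < P.eval y := lt_of_le_of_ne hs (fun e => by simp [← e] at h0)
        have : 0 < P.eval z := by by_contra hc; nlinarith
        nlinarith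

/-- Points of the curve over `K` with the sign sequence of `p`. -/
def signClass (f : Polynomial (Polynomial ℝ)) (K : Set ℝ) (p : ℝ × ℝ) : Set (ℝ × ℝ) :=
  {q | evXY f q = 0 ∧ q.1 ∈ K ∧ ∀ k ∈ Finset.Icc 1 f.natDegree,
    0 < evXY (dX2 k f) q * evXY (dX2 k f) p}

theorem pos_mul_of_pos_mul {a b c : ℝ} (h1 : 0 < a * c) (h2 : 0 < b * c) : 0 < a * b := by
  have h : 0 < (a * b) * (c * c) := by nlinarith [mul_pos h1 h2]
  by_contra hc
  nlinarith [mul_self_nonneg c]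

theorem signClass_unique_le (f : Polynomial (Polynomial ℝ)) (hd : 1 ≤ f.natDegree) (K : Set ℝ)
    (p : ℝ × ℝ) (x y z : ℝ) (hy : (x, y) ∈ signClass f K p) (hz : (x, z) ∈ signClass f K p)
    (hyz : y ≤ z) : y = z := by
  obtain ⟨hy0, _, hyk⟩ := hy
  obtain ⟨hz0, _, hzk⟩ := hz
  by_contra hne
  have hlt : y < z := lt_of_le_of_ne hyz hne
  set g := f.map (Polynomial.evalRingHom x) with hg
  have hgd : g.natDegree ≤ f.natDegree := Polynomial.natDegree_map_le
  have key := thom_segment (f.natDegree - 1) g.derivative y z hyz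
    ((Polynomial.natDegree_derivative_le g).trans (by omega))
    (fun k hk => by
      have hm : k + 1 ∈ Finset.Icc 1 f.natDegree := by
        rw [Finset.mem_Icc]; omega
      have := pos_mul_of_pos_mul (hyk _ hm) (hzk _ hm)
      rw [evXY_dX2, evXY_dX2, Function.iterate_succ_apply] at this
      exact this)
  have h1 : y ∈ Set.Icc y z := ⟨le_rfl, hyz⟩
  have h2 : z ∈ Set.Icc y z := ⟨hyz, le_rfl⟩
  have e1 : g.eval y = 0 := hy0
  have e2 : g.eval z = 0 := hz0
  rcases strict_of_deriv_sign g y z _ key with hm | hm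
  · have := hm h1 h2 hlt
    simp only [e1, e2, lt_self_iff_false] at this
  · have := hm h1 h2 hlt
    simp only [e1, e2, lt_self_iff_false] at this

theorem signClass_unique (f : Polynomial (Polynomial ℝ)) (hd : 1 ≤ f.natDegree) (K : Set ℝ)
    (p : ℝ × ℝ) (x y z : ℝ) (hy : (x, y) ∈ signClass f K p) (hz : (x, z) ∈ signClass f K p) :
    y = z := by
  rcases le_total y z with h | h
  · exact signClass_unique_le f hd K p x y z hy hz h
  · exact (signClass_unique_le f hd K p x z y hz hy h).symm

/-- Local lifting inside a sign class. -/
theorem signClass_lift (f : Polynomial (Polynomial ℝ)) (hd : 1 ≤ f.natDegree) (K : Set ℝ)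
    (hK : IsOpen K) (p : ℝ × ℝ) (x₀ y₀ : ℝ) (h : (x₀, y₀) ∈ signClass f K p) (ε : ℝ)
    (hε : 0 < ε) :
    ∀ᶠ x in nhds x₀, ∃ y, |y - y₀| < ε ∧ (x, y) ∈ signClass f K p := by
  obtain ⟨h0, hK0, hk⟩ := h
  have hev : ∀ᶠ q in nhds ((x₀, y₀) : ℝ × ℝ), ∀ k ∈ Finset.Icc 1 f.natDegree,
      0 < evXY (dX2 k f) q * evXY (dX2 k f) p := by
    rw [Filter.eventually_all_finset]
    intro k hkm
    exact ((evXY_continuous _).mul continuous_const).continuousAt.eventually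
      (lt_mem_nhds (hk k hkm))
  obtain ⟨r, hr, hball⟩ := Metric.eventually_nhds_iff.1 hev
  set e := min (r / 2) (ε / 2) with he
  have hepos : 0 < e := lt_min (by linarith) (by linarith)
  have her : e < r := lt_of_le_of_lt (min_le_left _ _) (by linarith)
  have heε : e < ε := lt_of_le_of_lt (min_le_right _ _) (by linarith)
  set g := f.map (Polynomial.evalRingHom x₀) with hg
  have hsm := strict_of_deriv_sign g (y₀ - e) (y₀ + e) (evXY (dX2 1 f) p) (by
    intro t ht
    have hq : dist ((x₀, t) : ℝ × ℝ) (x₀, y₀) < r := by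
      rw [Prod.dist_eq, dist_self, Real.dist_eq, max_lt_iff]
      refine ⟨hr, lt_of_le_of_lt ?_ her⟩
      rw [abs_le]
      constructor <;> linarith [ht.1, ht.2]
    have := hball hq 1 (by rw [Finset.mem_Icc]; omega)
    rw [evXY_dX2] at this
    exact this)
  have e0 : g.eval y₀ = 0 := h0
  have m1 : y₀ - e ∈ Set.Icc (y₀ - e) (y₀ + e) := ⟨by linarith, by linarith⟩
  have m2 : y₀ ∈ Set.Icc (y₀ - e) (y₀ + e) := ⟨by linarith, by linarith⟩
  have m3 : y₀ + e ∈ Set.Icc (y₀ - e) (y₀ + e) := ⟨by linarith, by linarith⟩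
  have hprod : evXY f (x₀, y₀ - e) * evXY f (x₀, y₀ + e) < 0 := by
    change g.eval (y₀ - e) * g.eval (y₀ + e) < 0
    rcases hsm with hm | hm
    · have a1 := hm m1 m2 (by linarith)
      have a2 := hm m2 m3 (by linarith)
      simp only [e0] at a1 a2
      exact mul_neg_of_neg_of_pos a1 a2
    · have a1 := hm m1 m2 (by linarith)
      have a2 := hm m2 m3 (by linarith)
      simp only [e0] at a1 a2
      exact mul_neg_of_pos_of_neg a1 a2
  have hc : Continuous fun x : ℝ => evXY f (x, y₀ - e) * evXY f (x, y₀ + e) :=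
    ((evXY_continuous f).comp (by fun_prop : Continuous fun x : ℝ => (x, y₀ - e))).mul
      ((evXY_continuous f).comp (by fun_prop : Continuous fun x : ℝ => (x, y₀ + e)))
  have ev1 := hc.continuousAt.eventually (gt_mem_nhds hprod)
  filter_upwards [ev1, hK.mem_nhds hK0, Metric.ball_mem_nhds x₀ hr] with x hx1 hxK hxr
  have hcy : ContinuousOn (fun y => evXY f (x, y)) (Set.uIcc (y₀ - e) (y₀ + e)) :=
    ((evXY_continuous f).comp (by fun_prop : Continuous fun y : ℝ => (x, y))).continuousOn
  have hiv := intermediate_value_uIcc hcy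
  have h0mem : (0 : ℝ) ∈ Set.uIcc (evXY f (x, y₀ - e)) (evXY f (x, y₀ + e)) := by
    rw [Set.mem_uIcc]
    rcases mul_neg_iff.1 hx1 with ⟨b1, b2⟩ | ⟨b1, b2⟩
    · right; exact ⟨b2.le, b1.le⟩
    · left; exact ⟨b1.le, b2.le⟩
  obtain ⟨y, hy, hy0⟩ := hiv h0mem
  rw [Set.uIcc_of_le (by linarith)] at hy
  have habs : |y - y₀| ≤ e := by
    rw [abs_le]
    constructor <;> linarith [hy.1, hy.2]
  refine ⟨y, lt_of_le_of_lt habs heε, hy0, hxK, hball ?_⟩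
  rw [Prod.dist_eq, max_lt_iff]
  exact ⟨hxr, lt_of_le_of_lt habs her⟩

/-- Locally uniform root bound. -/
theorem root_bound (f : Polynomial (Polynomial ℝ))
    (hlc : ∃ c : ℝ, c ≠ 0 ∧ f.leadingCoeff = Polynomial.C c) :
    ∃ B : ℝ → ℝ, Continuous B ∧ ∀ x y, evXY f (x, y) = 0 → |y| ≤ B x := by
  obtain ⟨c, hc, hcf⟩ := hlc
  refine ⟨fun x => (((Finset.range f.natDegree).sup
    (fun i => ‖(f.coeff i).eval x‖₊) / ‖c‖₊ + 1 : NNReal) : ℝ), ?_, ?_⟩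
  · have h1 : Continuous fun x : ℝ => (Finset.range f.natDegree).sup
        (fun i => ‖(f.coeff i).eval x‖₊) :=
      Continuous.finset_sup_apply (fun i _ => (f.coeff i).continuous.nnnorm)
    exact NNReal.continuous_coe.comp ((h1.div_const _).add continuous_const)
  · intro x y h
    have hl : Polynomial.evalRingHom x f.leadingCoeff ≠ 0 := by simpa [hcf] using hc
    have hne : f.map (Polynomial.evalRingHom x) ≠ 0 := by
      intro h0
      have := Polynomial.leadingCoeff_map_of_leadingCoeff_ne_zero _ hl
      rw [h0, Polynomial.leadingCoeff_zero] at this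
      exact hl this.symm
    have hb := Polynomial.IsRoot.norm_lt_cauchyBound hne (a := y) h
    unfold Polynomial.cauchyBound at hb
    rw [Polynomial.natDegree_map_of_leadingCoeff_ne_zero _ hl,
      Polynomial.leadingCoeff_map_of_leadingCoeff_ne_zero _ hl, hcf] at hb
    simp only [Polynomial.coeff_map, Polynomial.coe_evalRingHom, Polynomial.eval_C] at hb
    have := NNReal.coe_lt_coe.2 hb
    rw [coe_nnnorm, Real.norm_eq_abs] at this
    exact this.le

theorem signClass_closed (f : Polynomial (Polynomial ℝ))
    (hlc : ∃ c : ℝ, c ≠ 0 ∧ f.leadingCoeff = Polynomial.C c) (K : Set ℝ)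
    (hreg : ∀ k : ℕ, 1 ≤ k → k ≤ f.natDegree → ∀ p : ℝ × ℝ, p.1 ∈ K →
      evXY f p = 0 → evXY (dX2 k f) p ≠ 0)
    (p : ℝ × ℝ) (hp : evXY f p = 0) (hpK : p.1 ∈ K) :
    closure (Prod.fst '' signClass f K p) ∩ K ⊆ Prod.fst '' signClass f K p := by
  rintro x ⟨hx, hxK⟩
  obtain ⟨B, hB, hBr⟩ := root_bound f hlc
  obtain ⟨u, hu, hux⟩ := mem_closure_iff_seq_limit.1 hx
  choose q hq hqu using hu
  have hlim : Filter.Tendsto (fun n => B (u n)) Filter.atTop (nhds (B x)) :=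
    (hB.tendsto x).comp hux
  have hbd : ∀ᶠ n in Filter.atTop, (q n).2 ∈ Metric.closedBall (0 : ℝ) (B x + 1) := by
    filter_upwards [hlim.eventually (gt_mem_nhds (lt_add_one (B x)))] with n hn
    rw [mem_closedBall_zero_iff, Real.norm_eq_abs]
    have := hBr (q n).1 (q n).2 (hq n).1
    rw [hqu n] at this
    linarith
  obtain ⟨y, _, φ, hφ, hy⟩ :=
    (isCompact_closedBall (0 : ℝ) (B x + 1)).tendsto_subseq' hbd.frequently
  have hqlim : Filter.Tendsto (fun n => q (φ n)) Filter.atTop (nhds (x, y)) := by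
    rw [Prod.tendsto_iff]
    refine ⟨?_, hy⟩
    simp only [hqu]
    exact hux.comp hφ.tendsto_atTop
  have hzero : evXY f (x, y) = 0 := by
    refine tendsto_nhds_unique (((evXY_continuous f).tendsto (x, y)).comp hqlim) ?_
    have : (evXY f ∘ fun n => q (φ n)) = fun _ => 0 := funext fun n => (hq (φ n)).1
    rw [this]
    exact tendsto_const_nhds
  refine ⟨(x, y), ⟨hzero, hxK, fun k hk => ?_⟩, rfl⟩
  obtain ⟨k1, k2⟩ := Finset.mem_Icc.1 hk
  refine lt_of_le_of_ne ?_ (mul_ne_zero (hreg k k1 k2 (x, y) hxK hzero) (hreg k k1 k2 p hpK hp)).symm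
  refine ge_of_tendsto' ((((evXY_continuous (dX2 k f)).mul continuous_const).tendsto
    (x, y)).comp hqlim) (fun n => ?_)
  exact ((hq (φ n)).2.2 k hk).le

theorem signClass_preconnected (f : Polynomial (Polynomial ℝ)) (hd : 1 ≤ f.natDegree)
    (hlc : ∃ c : ℝ, c ≠ 0 ∧ f.leadingCoeff = Polynomial.C c) (K : Set ℝ)
    (hK : IsOpen K) (hKc : IsPreconnected K)
    (hreg : ∀ k : ℕ, 1 ≤ k → k ≤ f.natDegree → ∀ p : ℝ × ℝ, p.1 ∈ K →
      evXY f p = 0 → evXY (dX2 k f) p ≠ 0)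
    (p : ℝ × ℝ) (hp : evXY f p = 0) (hpK : p.1 ∈ K) (hpS : p ∈ signClass f K p) :
    IsPreconnected (signClass f K p) := by
  have hopen : IsOpen (Prod.fst '' signClass f K p) := by
    rw [isOpen_iff_mem_nhds]
    rintro _ ⟨⟨x, y⟩, hq, rfl⟩
    filter_upwards [signClass_lift f hd K hK p x y hq 1 one_pos] with x' hx'
    obtain ⟨y', _, h'⟩ := hx'
    exact ⟨(x', y'), h', rfl⟩
  have hsub : K ⊆ Prod.fst '' signClass f K p :=
    hKc.subset_of_closure_inter_subset hopen ⟨p.1, hpK, p, hpS, rfl⟩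
      (signClass_closed f hlc K hreg p hp hpK)
  have hex : ∀ x, ∃ y, x ∈ K → (x, y) ∈ signClass f K p := by
    intro x
    by_cases hx : x ∈ K
    · obtain ⟨⟨x', y⟩, hq, rfl⟩ := hsub hx
      exact ⟨y, fun _ => hq⟩
    · exact ⟨0, fun h => absurd h hx⟩
  choose g hg using hex
  have hcont : ContinuousOn g K := by
    intro x hx
    refine ContinuousAt.continuousWithinAt ?_
    rw [Metric.continuousAt_iff']
    intro ε hε
    filter_upwards [signClass_lift f hd K hK p x (g x) (hg x hx) ε hε, hK.mem_nhds hx]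
      with x' hx' hxK'
    obtain ⟨y', h1, h2⟩ := hx'
    rw [signClass_unique f hd K p x' (g x') y' (hg x' hxK') h2, Real.dist_eq]
    exact h1
  have himg : signClass f K p = (fun x => (x, g x)) '' K := by
    ext ⟨x, y⟩
    constructor
    · intro h
      refine ⟨x, h.2.1, ?_⟩
      simp only [Prod.mk.injEq, true_and]
      exact signClass_unique f hd K p x _ _ (hg x h.2.1) h
    · rintro ⟨x', hx', he⟩
      rw [← he]
      exact hg x' hx'
  rw [himg]
  exact hKc.image _ (continuousOn_id.prodMk hcont)

theorem mul_pos_of_sign_eq {a b : ℝ} (ha : a ≠ 0) (hb : b ≠ 0)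
    (h : Real.sign a = Real.sign b) : 0 < a * b := by
  rcases lt_or_gt_of_ne ha with h1 | h1 <;> rcases lt_or_gt_of_ne hb with h2 | h2
  · exact mul_pos_of_neg_of_neg h1 h2
  · rw [Real.sign_of_neg h1, Real.sign_of_pos h2] at h; norm_num at h
  · rw [Real.sign_of_pos h1, Real.sign_of_neg h2] at h; norm_num at h
  · exact mul_pos h1 h2

theorem components_identified_by_sign_sequence
    (f : Polynomial (Polynomial ℝ)) (hf : f ≠ 0) (hd : 1 ≤ f.natDegree)
    (hlc : ∃ c : ℝ, c ≠ 0 ∧ f.leadingCoeff = Polynomial.C c)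
    (a b : ℝ) (K : Set ℝ) (hK : K = Set.Ioo a b)
    (hreg : ∀ k : ℕ, 1 ≤ k → k ≤ f.natDegree → ∀ p : ℝ × ℝ, p.1 ∈ K →
      evXY f p = 0 → evXY (dX2 k f) p ≠ 0)
    (p p' : ℝ × ℝ)
    (hp : p ∈ {q : ℝ × ℝ | evXY f q = 0 ∧ q.1 ∈ K})
    (hp' : p' ∈ {q : ℝ × ℝ | evXY f q = 0 ∧ q.1 ∈ K})
    (hsign : ∀ k : ℕ, 1 ≤ k → k ≤ f.natDegree →
      ∀ q ∈ connectedComponentIn {q : ℝ × ℝ | evXY f q = 0 ∧ q.1 ∈ K} p,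
      ∀ q' ∈ connectedComponentIn {q : ℝ × ℝ | evXY f q = 0 ∧ q.1 ∈ K} p',
        Real.sign (evXY (dX2 k f) q) = Real.sign (evXY (dX2 k f) q')) :
    connectedComponentIn {q : ℝ × ℝ | evXY f q = 0 ∧ q.1 ∈ K} p
      = connectedComponentIn {q : ℝ × ℝ | evXY f q = 0 ∧ q.1 ∈ K} p' := by
  have hKo : IsOpen K := hK ▸ isOpen_Ioo
  have hKc : IsPreconnected K := hK ▸ isPreconnected_Ioo
  have hpS : p ∈ signClass f K p := by
    refine ⟨hp.1, hp.2, fun k hk => ?_⟩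
    obtain ⟨k1, k2⟩ := Finset.mem_Icc.1 hk
    exact mul_self_pos.2 (hreg k k1 k2 p hp.2 hp.1)
  have hpS' : p' ∈ signClass f K p := by
    refine ⟨hp'.1, hp'.2, fun k hk => ?_⟩
    obtain ⟨k1, k2⟩ := Finset.mem_Icc.1 hk
    exact mul_pos_of_sign_eq (hreg k k1 k2 p' hp'.2 hp'.1) (hreg k k1 k2 p hp.2 hp.1)
      (hsign k k1 k2 p (mem_connectedComponentIn hp) p' (mem_connectedComponentIn hp')).symm
  have hpre := signClass_preconnected f hd hlc K hKo hKc hreg p hp.1 hp.2 hpS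
  have hsub : signClass f K p ⊆ {q : ℝ × ℝ | evXY f q = 0 ∧ q.1 ∈ K} :=
    fun q hq => ⟨hq.1, hq.2.1⟩
  exact connectedComponentIn_eq (hpre.subset_connectedComponentIn hpS hsub hpS')
end

section
/- Assume the leading coefficient of f, viewed as a polynomial in x₂ with coefficients in ℝ[x₁], is a nonzero constant. Let K ⊂ ℝ be an open interval such that there is no point (x,y) ∈ ℝ² with x ∈ K, f(x,y) = 0 and ∂f/∂x₂(x,y) = 0. Then for every α ∈ K, every connected component C of Z_ℝ(f) ∩ π₁⁻¹(K) contains exactly one point with first coordinate α; consequently, the map sending a connected component C to the unique y ∈ ℝ with (α,y) ∈ C is a bijection between the set of connected components of Z_ℝ(f) ∩ π₁⁻¹(K) and the set of real roots of the univariate polynomial f(α, x₂). -/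
open Topology Filter in
theorem covering_component_fiber {S B : Type*} [TopologicalSpace S] [TopologicalSpace B]
    [SimplyConnectedSpace B] [LocallyPathConnectedSpace B] {p : S → B} (cov : IsCoveringMap p)
    (s : S) (x : B) : ∃! t, t ∈ connectedComponent s ∧ p t = x := by
  obtain ⟨F, ⟨hF0, hF⟩, -⟩ := cov.existsUnique_continuousMap_lifts
    (ContinuousMap.id B) (p s) s rfl
  have hFx : ∀ b, p (F b) = b := fun b => congrFun hF b
  have hsub : Set.range F ⊆ connectedComponent s :=
    (isPreconnected_range F.continuous).subset_connectedComponent ⟨p s, hF0⟩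
  refine ⟨F x, ⟨hsub ⟨x, rfl⟩, hFx x⟩, ?_⟩
  rintro t ⟨ht, rfl⟩
  have := cov.eqOn_of_comp_eqOn (g₁ := id) (g₂ := F ∘ p) (s := connectedComponent s)
    isPreconnected_connectedComponent continuousOn_id
    (F.continuous.comp cov.continuous).continuousOn
    (fun y _ => by simp [hFx]) (a := s) mem_connectedComponent (by simp [hF0])
  exact this ht

theorem evXY_eq_sum (f : Polynomial (Polynomial ℝ)) (p : ℝ × ℝ) :
    evXY f p = ∑ i ∈ Finset.range (f.natDegree + 1), (f.coeff i).eval p.1 * p.2 ^ i := by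
  rw [evXY, Polynomial.eval_map, Polynomial.eval₂_eq_sum_range]
  simp

theorem contDiff_evXY (f : Polynomial (Polynomial ℝ)) : ContDiff ℝ 1 (evXY f) := by
  have : evXY f = fun p => ∑ i ∈ Finset.range (f.natDegree + 1), (f.coeff i).eval p.1 * p.2 ^ i :=
    funext (evXY_eq_sum f)
  rw [this]
  refine ContDiff.sum fun i _ => ContDiff.mul ?_ (contDiff_snd.pow i)
  have h := (f.coeff i).contDiff_aeval (𝕜 := ℝ) 1
  simp only [Polynomial.coe_aeval_eq_eval] at h
  exact h.comp contDiff_fst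

theorem fderiv_evXY_inr (f : Polynomial (Polynomial ℝ)) (p : ℝ × ℝ) :
    fderiv ℝ (evXY f) p (0, 1) = evXY (Polynomial.derivative f) p := by
  have h1 : HasFDerivAt (evXY f) (fderiv ℝ (evXY f) p) (p.1, p.2) :=
    ((contDiff_evXY f).differentiable (by norm_num) p).hasFDerivAt
  have h2 : HasDerivAt (fun y : ℝ => (p.1, y)) ((0 : ℝ), (1 : ℝ)) p.2 :=
    (hasDerivAt_const _ _).prodMk (hasDerivAt_id _)
  have h3 := h1.comp_hasDerivAt p.2 h2
  have h4 : HasDerivAt (fun y : ℝ => evXY f (p.1, y)) (evXY (Polynomial.derivative f) p) p.2 := by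
    have := (Polynomial.map (Polynomial.evalRingHom p.1) f).hasDerivAt p.2
    simpa [evXY, Polynomial.derivative_map] using this
  exact h3.unique h4

open Topology Filter in
/-- Local form of the implicit function theorem for the curve. -/
theorem local_branch (f : Polynomial (Polynomial ℝ)) (p : ℝ × ℝ) (hp : evXY f p = 0)
    (hd : evXY (Polynomial.derivative f) p ≠ 0) :
    ∃ g : ℝ → ℝ, Tendsto g (𝓝 p.1) (𝓝 p.2) ∧ (∀ᶠ x in 𝓝 p.1, evXY f (x, g x) = 0) ∧
      ∀ᶠ v in 𝓝 p, evXY f v = 0 → g v.1 = v.2 := by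
  have hs : HasStrictFDerivAt (evXY f) (fderiv ℝ (evXY f) p) p :=
    (contDiff_evXY f).contDiffAt.hasStrictFDerivAt (by norm_num)
  have hinv : (fderiv ℝ (evXY f) p ∘L .inr ℝ ℝ ℝ).IsInvertible := by
    refine ⟨ContinuousLinearEquiv.unitsEquivAut ℝ (Units.mk0 _ hd), ?_⟩
    ext
    simp [fderiv_evXY_inr]
  refine ⟨hs.implicitFunctionOfProdDomain hinv, hs.tendsto_implicitFunctionOfProdDomain hinv, ?_, ?_⟩
  · simpa [hp] using hs.eventually_apply_implicitFunctionOfProdDomain hinv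
  · filter_upwards [hs.eventually_apply_eq_iff_implicitFunctionOfProdDomain hinv] with v hv h
    exact hv.1 (h.trans hp.symm)

theorem map_facts (f : Polynomial (Polynomial ℝ)) (c : ℝ) (hc : c ≠ 0)
    (hlc : f.leadingCoeff = Polynomial.C c) (x : ℝ) :
    (Polynomial.map (Polynomial.evalRingHom x) f).natDegree = f.natDegree ∧
    (Polynomial.map (Polynomial.evalRingHom x) f).leadingCoeff = c ∧
    Polynomial.map (Polynomial.evalRingHom x) f ≠ 0 := by
  have h : Polynomial.evalRingHom x f.leadingCoeff ≠ 0 := by simp [hlc, hc]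
  have h2 := Polynomial.leadingCoeff_map_of_leadingCoeff_ne_zero (Polynomial.evalRingHom x) h
  have h3 : (Polynomial.map (Polynomial.evalRingHom x) f).leadingCoeff = c := by
    rw [h2, hlc]; simp
  refine ⟨Polynomial.natDegree_map_of_leadingCoeff_ne_zero _ h, h3, ?_⟩
  rw [← Polynomial.leadingCoeff_ne_zero, h3]
  exact hc

theorem root_bound_s2 (f : Polynomial (Polynomial ℝ)) (c : ℝ) (hc : c ≠ 0)
    (hlc : f.leadingCoeff = Polynomial.C c) (k : Set ℝ) (hk : IsCompact k) :
    ∃ R : ℝ, ∀ p : ℝ × ℝ, p.1 ∈ k → evXY f p = 0 → ‖p.2‖ ≤ R := by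
  have hcont : Continuous fun x : ℝ => ∑ i ∈ Finset.range f.natDegree, ‖(f.coeff i).eval x‖ :=
    continuous_finsetSum _ fun i _ => (f.coeff i).continuous.norm
  obtain ⟨M, hM⟩ := hk.exists_bound_of_continuousOn hcont.continuousOn
  refine ⟨M / ‖c‖ + 1, fun p hp h0 => ?_⟩
  obtain ⟨h1, h2, h3⟩ := map_facts f c hc hlc p.1
  have hb : ‖p.2‖ < (((Polynomial.map (Polynomial.evalRingHom p.1) f).cauchyBound : NNReal) : ℝ) :=
    Polynomial.IsRoot.norm_lt_cauchyBound h3 h0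
  refine hb.le.trans ?_
  have hM' := hM p.1 hp
  have hM0 : 0 ≤ M := (norm_nonneg _).trans hM'
  rw [Polynomial.cauchyBound, h1, h2]
  rw [NNReal.coe_add, NNReal.coe_div, coe_nnnorm, NNReal.coe_one]
  refine add_le_add (div_le_div_of_nonneg_right ?_ (norm_nonneg c)) le_rfl
  rw [← NNReal.coe_mk M hM0, NNReal.coe_le_coe]
  refine Finset.sup_le fun i hi => ?_
  rw [← NNReal.coe_le_coe]
  simp only [Polynomial.coeff_map, Polynomial.coe_evalRingHom, coe_nnnorm, NNReal.coe_mk]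
  refine le_trans ?_ ((le_abs_self _).trans hM')
  exact Finset.single_le_sum (f := fun i => ‖(f.coeff i).eval p.1‖)
    (fun _ _ => norm_nonneg _) hi

open Topology Filter in
theorem isCoveringMap_proj (f : Polynomial (Polynomial ℝ)) (c : ℝ) (hc : c ≠ 0)
    (hlc : f.leadingCoeff = Polynomial.C c) (K : Set ℝ) (hKo : IsOpen K)
    (hreg : ∀ p : ℝ × ℝ, p.1 ∈ K → evXY f p = 0 → evXY (Polynomial.derivative f) p ≠ 0) :
    IsCoveringMap (fun s : {q : ℝ × ℝ | evXY f q = 0 ∧ q.1 ∈ K} => (⟨s.1.1, s.2.2⟩ : K)) := by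
  set p := fun s : {q : ℝ × ℝ | evXY f q = 0 ∧ q.1 ∈ K} => (⟨s.1.1, s.2.2⟩ : K) with hpdef
  have hcont : Continuous p := by fun_prop
  have : LocallyCompactSpace K := hKo.locallyCompactSpace
  have hproper : IsProperMap p := by
    refine isProperMap_iff_isCompact_preimage.2 ⟨hcont, fun k hk => ?_⟩
    have hk' : IsCompact (Subtype.val '' k) := hk.image continuous_subtype_val
    obtain ⟨R, hR⟩ := root_bound_s2 f c hc hlc _ hk'
    rw [Topology.IsEmbedding.subtypeVal.isCompact_iff]
    have hZ : IsClosed {q : ℝ × ℝ | evXY f q = 0} :=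
      isClosed_eq (contDiff_evXY f).continuous continuous_const
    have hcomp : IsCompact (((Subtype.val '' k) ×ˢ Metric.closedBall (0 : ℝ) R) ∩
        {q : ℝ × ℝ | evXY f q = 0}) :=
      (hk'.prod (isCompact_closedBall _ _)).inter_right hZ
    convert hcomp using 1
    ext q
    constructor
    · rintro ⟨s, hs, rfl⟩
      have hm : s.1.1 ∈ Subtype.val '' k := ⟨p s, hs, rfl⟩
      exact ⟨⟨hm, by simpa using hR _ hm s.2.1⟩, s.2.1⟩
    · rintro ⟨⟨⟨x, hx, hxq⟩, -⟩, h0⟩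
      have hqK : q.1 ∈ K := hxq ▸ x.2
      refine ⟨⟨q, h0, hqK⟩, ?_, rfl⟩
      have : p ⟨q, h0, hqK⟩ = x := Subtype.ext hxq.symm
      rw [Set.mem_preimage, this]
      exact hx
  have hopen : IsOpenMap p := by
    rw [isOpenMap_iff_nhds_le]
    intro s
    obtain ⟨g, hg, hg0, -⟩ := local_branch f s.1 s.2.1 (hreg _ s.2.2 s.2.1)
    intro W hW
    rw [mem_map] at hW
    rw [nhds_subtype, mem_comap] at hW
    obtain ⟨V, hV, hVW⟩ := hW
    have ht : Tendsto (fun x => (x, g x)) (𝓝 s.1.1) (𝓝 s.1) := by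
      have := (tendsto_id (x := 𝓝 s.1.1)).prodMk_nhds hg
      simpa using this
    have hev : ∀ᶠ x in 𝓝 s.1.1, evXY f (x, g x) = 0 ∧ (x, g x) ∈ V := hg0.and (ht hV)
    have hev' := (continuous_subtype_val (p := (· ∈ K))).continuousAt (x := p s) |>.eventually hev
    filter_upwards [hev'] with x hx
    exact hVW (show (⟨(x.1, g x.1), hx.1, x.2⟩ : {q : ℝ × ℝ | evXY f q = 0 ∧ q.1 ∈ K}) ∈
      Subtype.val ⁻¹' V from hx.2)
  rw [isCoveringMap_iff_isCoveringMapOn_univ]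
  refine hproper.isClosedMap.isCoveringMapOn_of_isLocalHomeomorphOn ?_ ?_
  · intro x _
    refine Set.Finite.of_finite_image (f := fun s => s.1.2) ?_ ?_
    · refine (Polynomial.finite_setOfPred_isRoot (map_facts f c hc hlc x.1).2.2).subset ?_
      rintro _ ⟨s, hs, rfl⟩
      have hx : s.1.1 = x.1 := congrArg Subtype.val hs
      have := s.2.1
      rw [evXY, hx] at this
      exact this
    · intro s hs t ht h
      have hx : p s = p t := hs.trans ht.symm
      exact Subtype.ext (Prod.ext (congrArg Subtype.val hx) h)
  · rw [isLocalHomeomorphOn_iff_isOpenEmbedding_restrict]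
    intro s _
    obtain ⟨g, -, -, hg⟩ := local_branch f s.1 s.2.1 (hreg _ s.2.2 s.2.1)
    obtain ⟨V, hV, hVo, hsV⟩ := eventually_nhds_iff.1 hg
    have hUo : IsOpen (Subtype.val ⁻¹' V : Set {q : ℝ × ℝ | evXY f q = 0 ∧ q.1 ∈ K}) :=
      hVo.preimage continuous_subtype_val
    refine ⟨_, hUo.mem_nhds hsV, ?_⟩
    refine .of_continuous_injective_isOpenMap (hcont.comp continuous_subtype_val) ?_
      (hopen.comp hUo.isOpenMap_subtype_val)
    rintro ⟨u, hu⟩ ⟨v, hv⟩ huv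
    have hx : u.1.1 = v.1.1 := congrArg Subtype.val huv
    have h1 := hV _ hu u.2.1
    have h2 := hV _ hv v.2.1
    exact Subtype.ext (Subtype.ext (Prod.ext hx (by rw [← h1, ← h2, hx])))

theorem components_in_bijection_with_fiber
    (f : Polynomial (Polynomial ℝ)) (hf : f ≠ 0) (hd : 1 ≤ f.natDegree)
    (hlc : ∃ c : ℝ, c ≠ 0 ∧ f.leadingCoeff = Polynomial.C c)
    (a b : ℝ) (K : Set ℝ) (hK : K = Set.Ioo a b)
    (hreg : ∀ p : ℝ × ℝ, p.1 ∈ K → evXY f p = 0 →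
      evXY (Polynomial.derivative f) p ≠ 0) :
    ∀ α ∈ K,
      (∀ C ∈ {C : Set (ℝ × ℝ) | ∃ p ∈ {q : ℝ × ℝ | evXY f q = 0 ∧ q.1 ∈ K},
          C = connectedComponentIn {q : ℝ × ℝ | evXY f q = 0 ∧ q.1 ∈ K} p},
        ∃! y : ℝ, (α, y) ∈ C) ∧
      ∃ φ : Set (ℝ × ℝ) → ℝ,
        (∀ C ∈ {C : Set (ℝ × ℝ) | ∃ p ∈ {q : ℝ × ℝ | evXY f q = 0 ∧ q.1 ∈ K},
            C = connectedComponentIn {q : ℝ × ℝ | evXY f q = 0 ∧ q.1 ∈ K} p},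
          (α, φ C) ∈ C) ∧
        Set.BijOn φ
          {C : Set (ℝ × ℝ) | ∃ p ∈ {q : ℝ × ℝ | evXY f q = 0 ∧ q.1 ∈ K},
            C = connectedComponentIn {q : ℝ × ℝ | evXY f q = 0 ∧ q.1 ∈ K} p}
          {y : ℝ | evXY f (α, y) = 0} := by
  obtain ⟨c, hc, hlc⟩ := hlc
  have hKo : IsOpen K := hK ▸ isOpen_Ioo
  have cov := isCoveringMap_proj f c hc hlc K hKo hreg
  intro α hα
  have hconv : Convex ℝ K := hK ▸ convex_Ioo a b
  have : ContractibleSpace K := hconv.contractibleSpace ⟨α, hα⟩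
  have : LocallyPathConnectedSpace K := hKo.locallyPathConnectedSpace
  set S := {q : ℝ × ℝ | evXY f q = 0 ∧ q.1 ∈ K} with hS
  have key : ∀ C ∈ {C : Set (ℝ × ℝ) | ∃ p ∈ S, C = connectedComponentIn S p},
      ∃! y : ℝ, (α, y) ∈ C := by
    rintro C ⟨q, hq, rfl⟩
    obtain ⟨t, ⟨ht, hta⟩, hu⟩ := covering_component_fiber cov (⟨q, hq⟩ : S) ⟨α, hα⟩
    rw [connectedComponentIn_eq_image hq]
    have hta' : t.1.1 = α := congrArg Subtype.val hta
    refine ⟨t.1.2, ⟨t, ht, Prod.ext hta' rfl⟩, ?_⟩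
    rintro y ⟨s, hs, hsy⟩
    have := hu s ⟨hs, Subtype.ext (by simp [hsy])⟩
    rw [← this, hsy]
  refine ⟨key, ?_⟩
  classical
  choose! φ hφ hφu using key
  refine ⟨φ, hφ, ?_, ?_, ?_⟩
  · rintro C hC
    have h := hφ C hC
    obtain ⟨q, hq, rfl⟩ := hC
    exact (connectedComponentIn_subset _ _ h).1
  · intro C hC D hD h
    have h1 := hφ C hC
    have h2 := hφ D hD
    rw [← h] at h2
    generalize φ C = y at h1 h2
    obtain ⟨q, hq, rfl⟩ := hC
    obtain ⟨r, hr, rfl⟩ := hD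
    rw [connectedComponentIn_eq h1, connectedComponentIn_eq h2]
  · intro y hy
    have hyS : (α, y) ∈ S := ⟨hy, hα⟩
    refine ⟨connectedComponentIn S (α, y), ⟨_, hyS, rfl⟩, ?_⟩
    exact (hφu _ ⟨_, hyS, rfl⟩ y (mem_connectedComponentIn hyS)).symm
end

section
/- Let f ∈ ℚ[x₁,x₂] be a nonconstant square-free polynomial. Then there exist an integer r ≥ 1 and polynomials f₁,…,f_r ∈ ℚ[x₁,x₂] such that f = f₁ ⋯ f_r and every f_i satisfies condition (S): for every integer k with 1 ≤ k ≤ deg_{x₂}(f_i), the set {(x,y) ∈ ℂ² : f_i(x,y) = 0 and ∂^k f_i/∂x₂^k (x,y) = 0} is finite. -/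
open MvPolynomial in
theorem aux_pderiv {σ : Type*} (i : σ) (p : MvPolynomial σ ℚ) (h : 0 < p.degreeOf i) :
    pderiv i p ≠ 0 ∧ (pderiv i p).degreeOf i + 1 = p.degreeOf i := by
  classical
  have hp : p.support.Nonempty := by
    rw [Finset.nonempty_iff_ne_empty]
    intro h0
    rw [MvPolynomial.support_eq_empty] at h0
    simp [h0] at h
  obtain ⟨m, hm, hmd⟩ := Finset.exists_mem_eq_sup p.support hp (fun m => m i)
  rw [← degreeOf_eq_sup] at hmd
  have hm1 : m - Finsupp.single i 1 + Finsupp.single i 1 = m := by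
    apply tsub_add_cancel_of_le
    rw [Finsupp.single_le_iff]
    omega
  have hc : coeff (m - Finsupp.single i 1) (pderiv i p) ≠ 0 := by
    rw [coeff_pderiv, hm1]
    exact mul_ne_zero (mem_support_iff.mp hm) (by positivity)
  have hlow := monomial_le_degreeOf i (mem_support_iff.mpr hc)
  refine ⟨fun h0 => hc (by simp [h0]), ?_⟩
  have hup : (pderiv i p).degreeOf i < p.degreeOf i := by
    rw [degreeOf_lt_iff h]
    intro n hn
    have := mem_support_iff.mp hn
    rw [coeff_pderiv] at this
    have := monomial_le_degreeOf i (mem_support_iff.mpr (left_ne_zero_of_mul this))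
    simp at this
    omega
  simp at hlow
  omega

open MvPolynomial in
theorem aux_iter {σ : Type*} (i : σ) (p : MvPolynomial σ ℚ) (hp : p ≠ 0) (k : ℕ)
    (h : k ≤ p.degreeOf i) :
    (pderiv i)^[k] p ≠ 0 ∧ ((pderiv i)^[k] p).degreeOf i + k = p.degreeOf i := by
  induction k with
  | zero => exact ⟨hp, rfl⟩
  | succ k ih =>
    obtain ⟨h1, h2⟩ := ih (by omega)
    rw [Function.iterate_succ_apply']
    obtain ⟨h3, h4⟩ := aux_pderiv i ((pderiv i)^[k] p) (by omega)
    exact ⟨h3, by omega⟩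

theorem aux_not_dvd {σ : Type*} (i : σ) (p q : MvPolynomial σ ℚ) (hq : q ≠ 0)
    (h : q.degreeOf i < p.degreeOf i) : ¬ p ∣ q := by
  rintro ⟨r, rfl⟩
  rw [MvPolynomial.degreeOf_mul_eq (left_ne_zero_of_mul hq) (right_ne_zero_of_mul hq)] at h
  omega

open Polynomial in
theorem aux_elim {R : Type*} [CommRing R] [IsDomain R] [NormalizedGCDMonoid R] (G H : R[X])
    (hG : Irreducible G) (hGH : ¬ G ∣ H) :
    ∃ d : R, d ≠ 0 ∧ ∃ u v : R[X], u * G + v * H = C d := by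
  by_cases h0 : G.natDegree = 0
  · rw [natDegree_eq_zero] at h0
    obtain ⟨c, rfl⟩ := h0
    exact ⟨c, fun h => hG.ne_zero (by simp [h]), 1, 0, by simp⟩
  let K := FractionRing R
  have hprim := hG.isPrimitive h0
  have hirr := (hprim.irreducible_iff_irreducible_map_fraction_map (K := K)).mp hG
  have hnd : ¬ G.map (algebraMap R K) ∣ H.map (algebraMap R K) :=
    fun h => hGH (hprim.dvd_of_fraction_map_dvd_fraction_map h)
  obtain ⟨u, v, huv⟩ := hirr.coprime_iff_not_dvd.mpr hnd
  obtain ⟨a, ha, hau⟩ := IsLocalization.integerNormalization_spec (nonZeroDivisors R) u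
  obtain ⟨b, hb, hbv⟩ := IsLocalization.integerNormalization_spec (nonZeroDivisors R) v
  refine ⟨a * b, mul_ne_zero (nonZeroDivisors.ne_zero ha) (nonZeroDivisors.ne_zero hb),
    C b * IsLocalization.integerNormalization (nonZeroDivisors R) u,
    C a * IsLocalization.integerNormalization (nonZeroDivisors R) v, ?_⟩
  apply Polynomial.map_injective (algebraMap R K) (IsFractionRing.injective R K)
  simp only [Polynomial.map_add, Polynomial.map_mul, hau, hbv, Polynomial.map_C]
  rw [← algebraMap_smul K a u, ← algebraMap_smul K b v, Polynomial.smul_eq_C_mul,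
    Polynomial.smul_eq_C_mul, _root_.map_mul, C_mul]
  linear_combination (C (algebraMap R K a) * C (algebraMap R K b)) * huv

open MvPolynomial in
theorem aux_finite (g h : MvPolynomial (Fin 2) ℚ) (hg : Irreducible g) (hgh : ¬ g ∣ h) :
    ∃ S : Set ℂ, S.Finite ∧ ∀ x y : ℂ, aeval ![x, y] g = 0 → aeval ![x, y] h = 0 → y ∈ S := by
  let e := finSuccEquiv ℚ 1
  let _ : NormalizedGCDMonoid (MvPolynomial (Fin 1) ℚ) :=
    Classical.choice inferInstance
  obtain ⟨d, hd, u, v, huv⟩ := aux_elim (e g) (e h)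
    ((MulEquiv.irreducible_iff e).mpr hg) (fun hh => hgh ((map_dvd_iff e).mp hh))
  let q := uniqueAlgEquiv ℚ (Fin 1) d
  have hq : q ≠ 0 := fun h0 => hd ((uniqueAlgEquiv ℚ (Fin 1)).injective (h0.trans (_root_.map_zero _).symm))
  refine ⟨{y | Polynomial.aeval y q = 0}, ?_, ?_⟩
  · refine (q.rootSet_finite ℂ).subset ?_
    intro y hy
    exact (Polynomial.mem_rootSet).mpr ⟨hq, hy⟩
  · intro x y h1 h2
    have h3 : e.symm u * g + e.symm v * h = rename Fin.succ d := by
      apply e.injective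
      simp only [_root_.map_add, _root_.map_mul, AlgEquiv.apply_symm_apply, huv]
      clear hd huv hq
      induction d using MvPolynomial.induction_on with
      | C a => simp [e, finSuccEquiv_apply]
      | add p q hp hq => simp only [_root_.map_add, hp, hq]
      | mul_X p i hp =>
        rw [_root_.map_mul, _root_.map_mul, _root_.map_mul, hp, rename_X]
        simp [e, finSuccEquiv_X_succ]
    have h4 := congrArg (aeval ![x, y]) h3
    rw [_root_.map_add, _root_.map_mul, _root_.map_mul, h1, h2, aeval_rename] at h4
    show Polynomial.aeval y q = 0
    have h5 : Polynomial.aeval y q = aeval (fun _ => y) d := by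
      rw [Polynomial.aeval_def, eval₂_const_uniqueAlgEquiv, aeval_def]
    have h6 : (![x, y] ∘ Fin.succ : Fin 1 → ℂ) = fun _ => y := by
      funext i; fin_cases i; rfl
    rw [h5, ← h6, ← h4]; simp

open MvPolynomial in
theorem aux_main (g h : MvPolynomial (Fin 2) ℚ) (hg : Irreducible g) (hgh : ¬ g ∣ h) :
    Set.Finite {p : ℂ × ℂ | aeval ![p.1, p.2] g = 0 ∧ aeval ![p.1, p.2] h = 0} := by
  obtain ⟨S, hS, hS'⟩ := aux_finite g h hg hgh
  let e := renameEquiv ℚ (Equiv.swap (0 : Fin 2) 1)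
  obtain ⟨T, hT, hT'⟩ := aux_finite (e g) (e h)
    ((MulEquiv.irreducible_iff e).mpr hg) (fun hh => hgh ((map_dvd_iff e).mp hh))
  refine (hT.prod hS).subset ?_
  rintro ⟨x, y⟩ ⟨h1, h2⟩
  have hs : (![y, x] ∘ Equiv.swap (0 : Fin 2) 1 : Fin 2 → ℂ) = ![x, y] := by
    funext i; fin_cases i <;> simp
  have key : ∀ p, aeval ![y, x] (e p) = aeval ![x, y] p := by
    intro p
    show aeval ![y, x] (rename _ p) = _
    rw [aeval_rename, hs]
  exact ⟨hT' y x (by rw [key]; exact h1) (by rw [key]; exact h2), hS' x y h1 h2⟩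

theorem squarefree_factorization_satisfying_S
    (f : MvPolynomial (Fin 2) ℚ)
    (hconst : 0 < f.totalDegree)
    (hsqf : Squarefree f) :
    ∃ (r : ℕ), 1 ≤ r ∧ ∃ g : Fin r → MvPolynomial (Fin 2) ℚ,
      f = ∏ i, g i ∧
      ∀ i : Fin r, ∀ k : ℕ, 1 ≤ k → k ≤ (g i).degreeOf 1 →
        Set.Finite {p : ℂ × ℂ |
          MvPolynomial.aeval ![p.1, p.2] (g i) = 0 ∧
          MvPolynomial.aeval ![p.1, p.2]
            ((⇑(MvPolynomial.pderiv (1 : Fin 2)))^[k] (g i)) = 0} := by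
  have hf0 : f ≠ 0 := by rintro rfl; simp at hconst
  have hfu : ¬ IsUnit f := by
    intro hu
    rw [MvPolynomial.isUnit_iff_eq_C_of_isReduced] at hu
    obtain ⟨r, _, rfl⟩ := hu
    simp at hconst
  obtain ⟨s, hs, hprod, hne⟩ := (WfDvdMonoid.not_isUnit_iff_exists_factors_eq f hf0).mp hfu
  induction s using Quotient.inductionOn with
  | h l =>
  refine ⟨l.length, ?_, l.get, ?_, ?_⟩
  · rw [Nat.one_le_iff_ne_zero]
    intro h0
    rw [List.length_eq_zero_iff] at h0
    exact hne (by simp [h0])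
  · rw [← hprod]
    simp [Fin.prod_univ_getElem]
  · intro i k hk hkd
    have hirr : Irreducible (l.get i) := hs _ (by simp)
    obtain ⟨h1, h2⟩ := aux_iter 1 (l.get i) hirr.ne_zero k hkd
    exact aux_main _ _ hirr (aux_not_dvd 1 _ _ h1 (by omega))
end

section
/- Assume that sing(C) is finite and let ζ ∈ reg(C). Then there exists a nonzero polynomial Ψ, with complex coefficients, in the n² entries of an n×n matrix, such that for every invertible matrix A ∈ GL_n(ℂ) with Ψ(A) ≠ 0 the following holds: for every z ∈ C, if the first coordinate of Az equals the first coordinate of Aζ and the second coordinate of Az equals the second coordinate of Aζ, then z = ζ. (In particular, for such A, the image of ζ under the projection of A·C to the first two coordinates is not a node of the projected curve.) -/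
open MvPolynomial

lemma gp_deriv {k K M : Type*} [Field k] [Field K] [Algebra k K] [AddCommGroup M] [Module K M]
    [Module k M] [IsScalarTower k K M] (n : ℕ)
    (x : Fin n → K) (D : Derivation k K M) (p : MvPolynomial (Fin n) k) :
    D (aeval x p) = ∑ j, aeval x (pderiv j p) • D (x j) := by
  induction p using MvPolynomial.induction_on with
  | C a => simp
  | add p q hp hq => simp [hp, hq, add_smul, Finset.sum_add_distrib]
  | mul_X p i hp =>
    simp [hp, add_smul, Finset.sum_add_distrib, Finset.smul_sum, smul_smul, mul_comm, pderiv_X,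
      Pi.single_apply, Finset.sum_ite_eq, apply_ite, ite_smul, add_comm]

open scoped IntermediateField.algebraAdjoinAdjoin in
lemma gp_alg {k K : Type*} [Field k] [Field K] [Algebra k K] (s : Set K)
    (h : Algebra.IsAlgebraic (IntermediateField.adjoin k s) K) :
    Algebra.IsAlgebraic (Algebra.adjoin k s) K :=
  (IsFractionRing.comap_isAlgebraic_iff (A := Algebra.adjoin k s)
    (K := IntermediateField.adjoin k s) (C := K)).2 h

lemma gp_trdeg (m : ℕ) (F : Fin m → MvPolynomial (Fin (m + 1)) ℂ)
    (P : Ideal (MvPolynomial (Fin (m + 1)) ℂ)) [P.IsPrime] (hF : ∀ i, F i ∈ P)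
    (e : Fin m → Fin (m + 1))
    (hdet : (Matrix.of fun i j => pderiv (e j) (F i)).det ∉ P) :
    Algebra.trdeg ℂ (MvPolynomial (Fin (m + 1)) ℂ ⧸ P) ≤ 1 := by
  let R := MvPolynomial (Fin (m + 1)) ℂ ⧸ P
  let K := FractionRing R
  have hinj : Function.Injective (algebraMap R K) := IsFractionRing.injective R K
  let x : Fin (m + 1) → K := fun j => algebraMap R K (Ideal.Quotient.mk P (X j))
  have hx : ∀ p, aeval x p = algebraMap R K (Ideal.Quotient.mk P p) := by
    intro p
    have : (aeval x : MvPolynomial (Fin (m + 1)) ℂ →ₐ[ℂ] K) =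
        (IsScalarTower.toAlgHom ℂ R K).comp (Ideal.Quotient.mkₐ ℂ P) := by
      ext j; simp [x]; rfl
    rw [this]; rfl
  have he : Function.Injective e := by
    intro a b hab
    by_contra hne
    apply hdet
    rw [Matrix.det_zero_of_column_eq hne (by intro i; simp [hab])]
    exact P.zero_mem
  obtain ⟨k, hk⟩ : ∃ k, k ∉ Set.range e := by
    by_contra! h
    have := Fintype.card_le_of_surjective e (fun k => h k)
    simp at this
  have hcov : ∀ j, j ≠ k → j ∈ Set.range e := by
    intro j hj
    by_contra hjr
    have h1 : Set.range e ⊆ (({j, k} : Finset (Fin (m+1)))ᶜ : Finset _) := by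
      rintro _ ⟨i, rfl⟩
      simp only [Finset.coe_compl, Set.mem_compl_iff, Finset.mem_coe, Finset.mem_insert, Finset.mem_singleton]
      rintro (h | h)
      · exact hjr ⟨i, h⟩
      · exact hk ⟨i, h⟩
    have h2 := Set.ncard_le_ncard h1
    rw [Set.ncard_range_of_injective he, Set.ncard_coe_finset, Finset.card_compl, Finset.card_pair hj] at h2
    simp at h2
    have : 1 ≤ m := by
      by_contra h0
      have : m = 0 := by omega
      subst this
      exact hj (Fin.ext (by omega))
    omega
  let L := IntermediateField.adjoin ℂ {x k}
  have hess : Algebra.EssFiniteType ℂ K := inferInstanceAs (Algebra.EssFiniteType ℂ (Localization _))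
  have hess' : Algebra.EssFiniteType L K := Algebra.EssFiniteType.of_comp ℂ L K
  let D := KaehlerDifferential.D L K
  have hDk : D (x k) = 0 := by
    have : x k = algebraMap L K ⟨x k, IntermediateField.mem_adjoin_simple_self ℂ _⟩ := rfl
    rw [this]; exact D.map_algebraMap _
  have hDp : ∀ p : MvPolynomial (Fin (m+1)) ℂ, D (aeval x p) = ∑ j, aeval x (pderiv j p) • D (x j) :=
    fun p => gp_deriv (m+1) x (D.restrictScalars ℂ) p
  have hsum : ∀ i, ∑ j, aeval x (pderiv (e j) (F i)) • D (x (e j)) = 0 := by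
    intro i
    have h1 := hDp (F i)
    rw [hx, (Ideal.Quotient.eq_zero_iff_mem).2 (hF i), map_zero, map_zero] at h1
    rw [h1]
    rw [← Finset.sum_image (s := Finset.univ) (g := e) (f := fun j => aeval x (pderiv j (F i)) • D (x j)) (fun a _ b _ h => he h)]
    apply Finset.sum_subset (Finset.subset_univ _)
    intro j _ hj
    have : j = k := by
      by_contra hjk
      obtain ⟨i, hi⟩ := hcov j hjk
      exact hj (by simp [← hi])
    rw [this, hDk, smul_zero]
  let N : Matrix (Fin m) (Fin m) K := Matrix.of fun i j => aeval x (pderiv (e j) (F i))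
  have hN : N.det ≠ 0 := by
    have : N.det = aeval x (Matrix.of fun i j => pderiv (e j) (F i)).det := by
      rw [AlgHom.map_det]; rfl
    rw [this, hx]
    intro h
    exact hdet ((Ideal.Quotient.eq_zero_iff_mem).1 (hinj (by rw [h, map_zero])))
  have hDe : ∀ j, D (x (e j)) = 0 := by
    intro j
    have h1 : N⁻¹ * N = 1 := Matrix.nonsing_inv_mul _ (isUnit_iff_ne_zero.2 hN)
    have h2 : ∑ i, N⁻¹ j i • ∑ l, N i l • D (x (e l)) = 0 := by
      apply Finset.sum_eq_zero
      intro i _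
      have := hsum i
      change N⁻¹ j i • ∑ l, aeval x (pderiv (e l) (F i)) • D (x (e l)) = 0
      rw [this, smul_zero]
    simp_rw [Finset.smul_sum, smul_smul] at h2
    rw [Finset.sum_comm] at h2
    simp_rw [← Finset.sum_smul, ← Matrix.mul_apply, h1, Matrix.one_apply] at h2
    simpa using h2
  have hDx : ∀ j, D (x j) = 0 := by
    intro j
    by_cases hj : j = k
    · rw [hj, hDk]
    · obtain ⟨i, rfl⟩ := hcov j hj
      exact hDe i
  have hD0 : ∀ y : K, D y = 0 := by
    intro y
    have hR : ∀ r : R, D (algebraMap R K r) = 0 := by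
      intro r
      obtain ⟨p, rfl⟩ := Ideal.Quotient.mk_surjective r
      rw [← hx, hDp]
      simp [hDx]
    obtain ⟨a, b, hb, rfl⟩ := IsFractionRing.div_surjective (A := R) y
    rw [Derivation.leibniz_div]
    simp [hR]
  have hsub : Subsingleton (Ω[K⁄L]) := by
    rw [← Submodule.subsingleton_iff K, ← subsingleton_iff_bot_eq_top, eq_comm, ← KaehlerDifferential.span_range_derivation, Submodule.span_eq_bot]
    rintro _ ⟨y, rfl⟩
    exact hD0 y
  have hunr : Algebra.FormallyUnramified L K := ⟨hsub⟩
  have hsep : Algebra.IsSeparable L K := Algebra.FormallyUnramified.isSeparable L K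
  have halg : Algebra.IsAlgebraic L K := inferInstance
  have halg2 : Algebra.IsAlgebraic (Algebra.adjoin ℂ {x k}) K := by
    exact gp_alg {x k} halg
  have h1 : Algebra.trdeg ℂ K ≤ 1 := by
    have := Algebra.IsAlgebraic.trdeg_le_cardinalMk ℂ ({x k} : Set K)
    simpa using this
  exact (trdeg_le_of_injective (IsScalarTower.toAlgHom ℂ R K) hinj).trans h1

lemma gp_dep (m : ℕ) (P : Ideal (MvPolynomial (Fin (m + 1)) ℂ)) [P.IsPrime]
    (htr : Algebra.trdeg ℂ (MvPolynomial (Fin (m + 1)) ℂ ⧸ P) ≤ 1)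
    (ζ : Fin (m + 1) → ℂ) (j : Fin (m + 1)) :
    ∃ Ψ : MvPolynomial (Fin (m + 1) × Fin 2) ℂ, Ψ ≠ 0 ∧
      ∀ z : Fin (m + 1) → ℂ, (∀ p ∈ P, aeval z p = 0) → z j ≠ ζ j →
      ∀ a : Fin (m + 1) × Fin 2 → ℂ, (∀ r, ∑ i, a (i, r) * (z i - ζ i) = 0) →
        eval a Ψ = 0 := by
  let R := MvPolynomial (Fin (m + 1)) ℂ ⧸ P
  let σ := {i : Fin (m + 1) // i ≠ j} × Fin 2
  let S := MvPolynomial σ R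
  let w : Fin (m + 1) → R := fun i => Ideal.Quotient.mk P (X i - C (ζ i))
  let g : Fin (m + 1) × Fin 2 → S := fun ir =>
    if h : ir.1 ≠ j then C (w j) * X (⟨ir.1, h⟩, ir.2)
    else - ∑ i' : {i : Fin (m + 1) // i ≠ j}, X (i', ir.2) * C (w i')
  have hS : Algebra.trdeg ℂ S ≤ (2 * m + 1 : ℕ) := by
    have h1 := _root_.trdeg_add_eq ℂ R (A := S)
    have h2 : Algebra.trdeg R S = (2 * m : ℕ) := by
      have : Algebra.trdeg R S = Cardinal.lift.{0} (Cardinal.mk σ) := MvPolynomial.trdeg_of_isDomain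
      rw [this, Cardinal.lift_id, Cardinal.mk_fintype]
      simp [σ, mul_comm]
    rw [← h1, h2]
    calc _ ≤ (1 : Cardinal) + (2 * m : ℕ) := by gcongr
      _ = _ := by push_cast; rw [add_comm]
  have hnot : ¬ AlgebraicIndependent ℂ g := by
    intro h
    have h1 := h.cardinalMk_le_trdeg.trans hS
    rw [Cardinal.mk_fintype] at h1
    have h2 := Nat.cast_le.1 h1
    simp at h2
    omega
  rw [algebraicIndependent_iff] at hnot
  push Not at hnot
  obtain ⟨Ψ, hΨ, hΨ0⟩ := hnot
  refine ⟨Ψ, hΨ0, ?_⟩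
  intro z hz hj a ha
  have hj' : z j - ζ j ≠ 0 := sub_ne_zero.2 hj
  let ρ : R →ₐ[ℂ] ℂ := Ideal.Quotient.liftₐ P (aeval z) hz
  have hw : ∀ i, ρ (w i) = z i - ζ i := by
    intro i
    have : ρ (w i) = aeval z (X i - C (ζ i)) := rfl
    rw [this]; simp
  let u : σ → ℂ := fun s => a (s.1, s.2) / (z j - ζ j)
  let θ : S →+* ℂ := eval₂Hom ρ.toRingHom u
  have hθC : ∀ r, θ (C r) = ρ r := fun r => eval₂Hom_C _ _ _
  have hθX : ∀ s, θ (X s) = u s := fun r => eval₂Hom_X' _ _ _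
  have hg : ∀ ir, θ (g ir) = a ir := by
    rintro ⟨i, r⟩
    by_cases h : i = j
    · subst h
      have hs := ha r
      rw [Fintype.sum_eq_add_sum_subtype_ne _ i] at hs
      simp only [g, ne_eq, not_true_eq_false, dite_false, map_neg, map_sum, map_mul, hθC, hθX, hw, u]
      have : ∑ x : {j // j ≠ i}, a (x.1, r) / (z i - ζ i) * (z x - ζ x)
          = (∑ x : {j // j ≠ i}, a (x.1, r) * (z x - ζ x)) / (z i - ζ i) := by
        rw [Finset.sum_div]
        exact Finset.sum_congr rfl fun x _ => by ring
      rw [this]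
      field_simp
      linear_combination -hs
    · simp only [g, ne_eq, h, not_false_eq_true, dite_true, map_mul, hθC, hθX, hw, u]
      field_simp
  have h3 : θ (aeval g Ψ) = eval a Ψ := by
    rw [MvPolynomial.map_aeval]
    have : θ.comp (algebraMap ℂ S) = RingHom.id ℂ := by
      ext c
      have : algebraMap ℂ S c = C (algebraMap ℂ R c) := rfl
      simp [this, hθC]
    rw [this, funext hg]
    rfl
  rw [← h3, hΨ, map_zero]

lemma gp_rank (m n : ℕ) (J : Matrix (Fin m) (Fin n) ℂ) (h : ¬ J.rank < m) :
    ∃ e : Fin m → Fin n, (Matrix.of fun i j => J i (e j)).det ≠ 0 := by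
  have hr : J.rank = m := le_antisymm (by simpa using J.rank_le_card_height) (not_lt.1 h)
  rw [Matrix.rank_eq_finrank_span_cols] at hr
  have hex := Submodule.exists_fun_fin_finrank_span_eq ℂ (Set.range J.col)
  rw [hr] at hex
  obtain ⟨c, hc, -, hli⟩ := hex
  choose e he using hc
  refine ⟨e, ?_⟩
  have : LinearIndependent ℂ (Matrix.of fun i j => J i (e j)).col := by
    have hcol : (Matrix.of fun i j => J i (e j)).col = c := by
      ext j i
      rw [← he j]
      rfl
    rw [hcol]
    exact hli
  rw [Matrix.linearIndependent_cols_iff_isUnit, Matrix.isUnit_iff_isUnit_det] at this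
  exact this.ne_zero

theorem generic_projection_separates_point
    (m : ℕ) (hm : 1 ≤ m)  -- n = m + 1 ≥ 2
    (f : Fin m → MvPolynomial (Fin (m + 1)) ℚ)
    -- the curve C ⊂ ℂⁿ
    (C : Set (Fin (m + 1) → ℂ))
    (hC : C = {z : Fin (m + 1) → ℂ | ∀ i, MvPolynomial.aeval z (f i) = 0})
    -- the Jacobian matrix J_f(z)
    (J : (Fin (m + 1) → ℂ) → Matrix (Fin m) (Fin (m + 1)) ℂ)
    (hJ : J = fun z => Matrix.of fun i j =>
      MvPolynomial.aeval z (MvPolynomial.pderiv j (f i)))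
    -- sing(C) is finite
    (hsing : Set.Finite {z ∈ C | (J z).rank < m})
    -- ζ is a regular point of C
    (ζ : Fin (m + 1) → ℂ)
    (hζ : ζ ∈ C \ {z ∈ C | (J z).rank < m}) :
    ∃ Ψ : MvPolynomial (Fin (m + 1) × Fin (m + 1)) ℂ, Ψ ≠ 0 ∧
      ∀ A : Matrix (Fin (m + 1)) (Fin (m + 1)) ℂ, IsUnit A.det →
        MvPolynomial.eval (fun ij => A ij.1 ij.2) Ψ ≠ 0 →
        ∀ z ∈ C,
          A.mulVec z 0 = A.mulVec ζ 0 →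
          A.mulVec z 1 = A.mulVec ζ 1 →
          z = ζ := by
  classical
  subst hC
  subst hJ
  let F : Fin m → MvPolynomial (Fin (m + 1)) ℂ := fun i => map (algebraMap ℚ ℂ) (f i)
  have hFz : ∀ (z : Fin (m + 1) → ℂ) i, aeval z (F i) = aeval z (f i) := fun z i => by
    simp [F, aeval_map_algebraMap]
  have hFd : ∀ (z : Fin (m + 1) → ℂ) i j, aeval z (pderiv j (F i)) = aeval z (pderiv j (f i)) :=
    fun z i j => by simp [F, pderiv_map, aeval_map_algebraMap]
  let I : Ideal (MvPolynomial (Fin (m + 1)) ℂ) := Ideal.span (Set.range F)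
  have hIfin : I.minimalPrimes.Finite := I.finite_minimalPrimes_of_isNoetherianRing
  -- polynomials for the components
  have hcomp : ∀ (P : Ideal (MvPolynomial (Fin (m + 1)) ℂ)) (j : Fin (m + 1)),
      ∃ Ψ : MvPolynomial (Fin (m + 1) × Fin 2) ℂ, Ψ ≠ 0 ∧ (P ∈ I.minimalPrimes →
      ∀ z : Fin (m + 1) → ℂ, (∀ p ∈ P, aeval z p = 0) →
      ¬ (Matrix.of fun i j => aeval z (pderiv j (f i)) : Matrix (Fin m) (Fin (m + 1)) ℂ).rank < m →
      z j ≠ ζ j →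
      ∀ a : Fin (m + 1) × Fin 2 → ℂ, (∀ r, ∑ i, a (i, r) * (z i - ζ i) = 0) →
        eval a Ψ = 0) := by
    intro P j
    by_cases hP : P ∈ I.minimalPrimes
    · by_cases hdet : ∃ e : Fin m → Fin (m + 1),
          (Matrix.of fun i j => pderiv (e j) (F i)).det ∉ P
      · obtain ⟨e, he⟩ := hdet
        have : P.IsPrime := hP.1.1
        have hFP : ∀ i, F i ∈ P := fun i => hP.1.2 (Ideal.subset_span ⟨i, rfl⟩)
        obtain ⟨Ψ, h0, h1⟩ := gp_dep m P (gp_trdeg m F P hFP e he) ζ j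
        exact ⟨Ψ, h0, fun _ z hz _ => h1 z hz⟩
      · push Not at hdet
        refine ⟨1, one_ne_zero, fun _ z hz hr => ?_⟩
        obtain ⟨e, he⟩ := gp_rank _ _ _ hr
        exfalso
        apply he
        rw [← hz _ (hdet e), AlgHom.map_det]
        congr 1
        ext i j
        exact (hFd z i (e j)).symm
    · exact ⟨1, one_ne_zero, fun h => absurd h hP⟩
  choose Ψc hΨc0 hΨc using hcomp
  -- polynomials for the singular points
  have hpt : ∀ z : Fin (m + 1) → ℂ,
      ∃ Ψ : MvPolynomial (Fin (m + 1) × Fin 2) ℂ, Ψ ≠ 0 ∧ (z ≠ ζ →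
      ∀ a : Fin (m + 1) × Fin 2 → ℂ, (∀ r, ∑ i, a (i, r) * (z i - ζ i) = 0) →
        eval a Ψ = 0) := by
    intro z
    by_cases hz : z = ζ
    · exact ⟨1, one_ne_zero, fun h => absurd hz h⟩
    · obtain ⟨j, hj⟩ := Function.ne_iff.1 hz
      refine ⟨∑ i, X (i, 0) * C (z i - ζ i), ?_, fun _ a ha => by simpa using ha 0⟩
      intro h
      have h1 := congrArg (eval (Pi.single (j, 0) 1)) h
      simp [Pi.single_apply] at h1
      exact hj (sub_eq_zero.1 h1)
  choose Ψs hΨs0 hΨs using hpt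
  let Ψ : MvPolynomial (Fin (m + 1) × Fin 2) ℂ :=
    (∏ z ∈ hsing.toFinset, Ψs z) * ∏ P ∈ hIfin.toFinset, ∏ j, Ψc P j
  have hΨ : Ψ ≠ 0 := mul_ne_zero (Finset.prod_ne_zero_iff.2 fun z _ => hΨs0 z)
    (Finset.prod_ne_zero_iff.2 fun P _ => Finset.prod_ne_zero_iff.2 fun j _ => hΨc0 P j)
  have h01 : (0 : Fin (m + 1)) ≠ 1 := by
    intro h
    have h' := congrArg Fin.val h
    rw [Fin.val_zero, Fin.val_one', Nat.mod_eq_of_lt (by omega)] at h'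
    omega
  let ι : Fin 2 → Fin (m + 1) := fun r => if r = 0 then 0 else 1
  let τ : Fin (m + 1) × Fin 2 → Fin (m + 1) × Fin (m + 1) := fun ir => (ι ir.2, ir.1)
  have hι : Function.Injective ι := by
    intro r s h
    fin_cases r <;> fin_cases s <;> simp [ι, h01, h01.symm] at h ⊢
  have hτ : Function.Injective τ := by
    rintro ⟨i, r⟩ ⟨i', r'⟩ h
    simp only [τ, Prod.mk.injEq] at h
    rw [h.2, hι h.1]
  refine ⟨rename τ Ψ, fun h => hΨ (rename_injective τ hτ (by rw [h, map_zero])), ?_⟩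
  intro A _ hA z hz h0 h1
  by_contra hne
  apply hA
  rw [eval_rename]
  set a : Fin (m + 1) × Fin 2 → ℂ := (fun ij => A ij.1 ij.2) ∘ τ with ha_def
  have hrow : ∀ k, A.mulVec z k = A.mulVec ζ k → ∑ i, A k i * (z i - ζ i) = 0 := by
    intro k hk
    simp only [mul_sub, Finset.sum_sub_distrib]
    exact sub_eq_zero.2 hk
  have ha : ∀ r, ∑ i, a (i, r) * (z i - ζ i) = 0 := by
    intro r
    fin_cases r
    · exact hrow 0 h0
    · exact hrow 1 h1
  simp only [Ψ, map_mul, map_prod]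
  by_cases hs : (Matrix.of fun i j => aeval z (pderiv j (f i)) :
      Matrix (Fin m) (Fin (m + 1)) ℂ).rank < m
  · apply mul_eq_zero_of_left
    exact Finset.prod_eq_zero (i := z) (by simpa using ⟨hz, hs⟩) (hΨs z hne a ha)
  · apply mul_eq_zero_of_right
    have hprime : (RingHom.ker (aeval z : MvPolynomial (Fin (m + 1)) ℂ →ₐ[ℂ] ℂ)).IsPrime :=
      RingHom.ker_isPrime _
    have hle : I ≤ RingHom.ker (aeval z : MvPolynomial (Fin (m + 1)) ℂ →ₐ[ℂ] ℂ) := by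
      rw [Ideal.span_le]
      rintro _ ⟨i, rfl⟩
      exact (hFz z i).trans (hz i)
    obtain ⟨P, hP, hPz⟩ := Ideal.exists_minimalPrimes_le hle
    obtain ⟨j, hj⟩ := Function.ne_iff.1 hne
    refine Finset.prod_eq_zero (i := P) (by simpa using hP) ?_
    exact Finset.prod_eq_zero (i := j) (Finset.mem_univ _)
      (hΨc P j hP z (fun p hp => hPz hp) hs hj a ha)
end

section
/- Assume that sing(C) is finite and let F ⊂ reg(C) be a finite set. Then there exists a nonzero polynomial Ψ, with complex coefficients, in the n² entries of an n×n matrix, such that for every invertible matrix A ∈ GL_n(ℂ) with Ψ(A) ≠ 0 the following holds: for every ζ ∈ F and every z ∈ C, if the first coordinate of Az equals the first coordinate of Aζ and the second coordinate of Az equals the second coordinate of Aζ, then z = ζ. (Equivalently, there is a nonempty Zariski open subset 𝒜 ⊂ GL_n(ℂ) such that for every A ∈ 𝒜, the projection onto the first two coordinates, composed with A, separates each point of F from every other point of C.) -/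
open MvPolynomial

def ThinSet {σ : Type*} (B : Set (σ → ℂ)) : Prop :=
  ∃ Ψ : MvPolynomial σ ℂ, Ψ ≠ 0 ∧ ∀ a ∈ B, eval a Ψ = 0

lemma ThinSet.biUnion {σ ι : Type*} {s : Set ι} (hs : s.Finite) (B : ι → Set (σ → ℂ))
    (h : ∀ i ∈ s, ThinSet (B i)) : ThinSet (⋃ i ∈ s, B i) := by
  classical
  choose! Ψ h0 h1 using h
  refine ⟨∏ i ∈ hs.toFinset, Ψ i, ?_, ?_⟩
  · rw [Finset.prod_ne_zero_iff]
    intro i hi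
    exact h0 i (by simpa using hi)
  · intro a ha
    simp only [Set.mem_iUnion] at ha
    obtain ⟨i, hi, ha⟩ := ha
    rw [map_prod]
    exact Finset.prod_eq_zero (i := i) (by simpa using hi) (h1 i hi a ha)

lemma ThinSet.mono {σ : Type*} {B B' : Set (σ → ℂ)} (h : B ⊆ B') (h' : ThinSet B') : ThinSet B := by
  obtain ⟨Ψ, h0, h1⟩ := h'
  exact ⟨Ψ, h0, fun a ha => h1 a (h ha)⟩

lemma ThinSet.union {σ : Type*} {B B' : Set (σ → ℂ)} (h : ThinSet B) (h' : ThinSet B') :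
    ThinSet (B ∪ B') := by
  obtain ⟨Ψ, h0, h1⟩ := h
  obtain ⟨Ψ', h0', h1'⟩ := h'
  refine ⟨Ψ * Ψ', mul_ne_zero h0 h0', ?_⟩
  rintro a (ha | ha)
  · simp [h1 a ha]
  · simp [h1' a ha]

/-- the chain rule -/
lemma deriv_chain {σ E K M : Type*} [Fintype σ] [Field E] [Field K] [Algebra E K] [Algebra ℂ E]
    [Algebra ℂ K] [IsScalarTower ℂ E K] [AddCommGroup M] [Module K M] [Module E M]
    (D : Derivation E K M) (π : MvPolynomial σ ℂ →ₐ[ℂ] K) (q : MvPolynomial σ ℂ) :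
    D (π q) = ∑ j, π (pderiv j q) • D (π (X j)) := by
  classical
  induction q using MvPolynomial.induction_on with
  | C a =>
    rw [← MvPolynomial.algebraMap_eq, AlgHom.commutes, IsScalarTower.algebraMap_apply ℂ E K]
    simp
  | add p q hp hq => simp [hp, hq, add_smul, Finset.sum_add_distrib]
  | mul_X p i hp =>
    rw [map_mul, Derivation.leibniz, hp]
    simp only [Derivation.leibniz, pderiv_X, add_smul, Finset.sum_add_distrib, smul_eq_mul,
      mul_smul, Finset.smul_sum, map_add, map_mul]
    congr 1
    rw [Finset.sum_eq_single i]
    · simp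
    · intro j _ hj
      simp [hj.symm]
    · simp

lemma derivation_vanishes {m : ℕ} {E K V : Type*} [Field E] [Field K] [Algebra E K] [Algebra ℂ E]
    [Algebra ℂ K] [IsScalarTower ℂ E K] [AddCommGroup V] [Module K V] [Module E V]
    (D : Derivation E K V) (π : MvPolynomial (Fin (m+1)) ℂ →ₐ[ℂ] K)
    (g : Fin m → MvPolynomial (Fin (m+1)) ℂ) (hg : ∀ i, π (g i) = 0) (j0 : Fin (m+1))
    (M : Matrix (Fin (m+1)) (Fin (m+1)) (MvPolynomial (Fin (m+1)) ℂ))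
    (hM0 : ∀ j, M 0 j = if j = j0 then 1 else 0)
    (hM1 : ∀ i j, M (Fin.succ i) j = pderiv j (g i))
    (hdet : π M.det ≠ 0) (hj0 : D (π (X j0)) = 0) (q : MvPolynomial (Fin (m+1)) ℂ) :
    D (π q) = 0 := by
  classical
  have hξ : ∀ j, D (π (X j)) = 0 := by
    have key : ∀ φ : Module.Dual K V, (fun j => φ (D (π (X j)))) = 0 := by
      intro φ
      apply Matrix.eq_zero_of_mulVec_eq_zero (M := M.map π)
      · rwa [← AlgHom.mapMatrix_apply, ← AlgHom.map_det]
      · funext i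
        simp only [Matrix.mulVec, dotProduct, Matrix.map_apply, Pi.zero_apply]
        refine Fin.cases ?_ (fun i => ?_) i
        · simp only [hM0]
          rw [Finset.sum_eq_single j0]
          · simp [hj0]
          · intro j _ hj
            simp [hj]
          · simp
        · simp only [hM1]
          have h := deriv_chain D π (g i)
          rw [hg, map_zero] at h
          have h2 := congrArg φ h
          rw [map_zero, map_sum] at h2
          rw [h2]
          refine Finset.sum_congr rfl fun j _ => ?_
          rw [map_smul, smul_eq_mul]
    intro j
    rw [← Module.forall_dual_apply_eq_zero_iff K]
    exact fun φ => congrFun (key φ) j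
  rw [deriv_chain]
  exact Finset.sum_eq_zero fun j _ => by rw [hξ, smul_zero]

lemma trdeg_le_one {m : ℕ} (R : Type) [CommRing R] [IsDomain R] [Algebra ℂ R]
    (ρ : MvPolynomial (Fin (m+1)) ℂ →ₐ[ℂ] R) (hρ : Function.Surjective ρ)
    (g : Fin m → MvPolynomial (Fin (m+1)) ℂ) (hg : ∀ i, ρ (g i) = 0) (j0 : Fin (m+1))
    (M : Matrix (Fin (m+1)) (Fin (m+1)) (MvPolynomial (Fin (m+1)) ℂ))
    (hM0 : ∀ j, M 0 j = if j = j0 then 1 else 0)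
    (hM1 : ∀ i j, M (Fin.succ i) j = pderiv j (g i))
    (hdet : ρ M.det ≠ 0) :
    Algebra.trdeg ℂ R ≤ 1 := by
  classical
  let K := FractionRing R
  let π : MvPolynomial (Fin (m+1)) ℂ →ₐ[ℂ] K := (IsScalarTower.toAlgHom ℂ R K).comp ρ
  have hπ : ∀ q, π q = algebraMap R K (ρ q) := fun q => rfl
  let E := IntermediateField.adjoin ℂ {π (X j0)}
  have hD0 : KaehlerDifferential.D E K (π (X j0)) = 0 :=
    (KaehlerDifferential.D E K).map_algebraMap
      (⟨π (X j0), IntermediateField.mem_adjoin_simple_self ℂ _⟩ : E)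
  have hS := derivation_vanishes (KaehlerDifferential.D E K) π g (fun i => by rw [hπ, hg, map_zero]) j0 M
    hM0 hM1 (by rw [hπ, Ne, FaithfulSMul.algebraMap_eq_zero_iff]; exact hdet) hD0
  have hK : ∀ x : K, KaehlerDifferential.D E K x = 0 := by
    intro x
    obtain ⟨a, b, hb, rfl⟩ := IsFractionRing.div_surjective (A := R) x
    obtain ⟨a, rfl⟩ := hρ a
    obtain ⟨b, rfl⟩ := hρ b
    rw [← hπ, ← hπ, Derivation.leibniz_div, hS, hS, smul_zero, smul_zero, sub_zero, smul_zero]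
  have hsub : Subsingleton (KaehlerDifferential E K) := by
    rw [← Submodule.subsingleton_iff K, ← subsingleton_iff_bot_eq_top,
      ← KaehlerDifferential.span_range_derivation, eq_comm, Submodule.span_eq_bot]
    rintro _ ⟨x, rfl⟩
    exact hK x
  have : Algebra.FormallyUnramified E K := ⟨hsub⟩
  have : Algebra.FiniteType ℂ R := Algebra.FiniteType.of_surjective ρ hρ
  have : Algebra.EssFiniteType R K := Algebra.EssFiniteType.of_isLocalization K (nonZeroDivisors R)
  have : Algebra.EssFiniteType ℂ K := Algebra.EssFiniteType.comp ℂ R K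
  have : Algebra.EssFiniteType E K := Algebra.EssFiniteType.of_comp ℂ E K
  have hsep : Algebra.IsSeparable E K := Algebra.FormallyUnramified.isSeparable E K
  have halg : Algebra.IsAlgebraic E K := inferInstance
  have : Algebra.IsAlgebraic (Algebra.adjoin ℂ {π (X j0)}) K := by
    open scoped IntermediateField.algebraAdjoinAdjoin in
    exact (IsFractionRing.comap_isAlgebraic_iff (A := Algebra.adjoin ℂ {π (X j0)})
      (K := IntermediateField.adjoin ℂ {π (X j0)})).2 halg
  have h1 : Algebra.trdeg ℂ K ≤ 1 := by
    have := Algebra.IsAlgebraic.trdeg_le_cardinalMk ℂ ({π (X j0)} : Set K)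
    simpa using this
  exact (trdeg_le_of_injective (IsScalarTower.toAlgHom ℂ R K) (IsFractionRing.injective R K)).trans h1

lemma thin_of_trdeg {m : ℕ} (hm : 1 ≤ m) (R : Type) [CommRing R] [IsDomain R] [Algebra ℂ R]
    (hR : Algebra.trdeg ℂ R ≤ 1) (x : Fin (m+1) → R) (k : Fin (m+1)) (ζ : Fin (m+1) → ℂ) :
    ThinSet {a : Fin (m+1) × Fin (m+1) → ℂ | ∃ φ : R →ₐ[ℂ] ℂ, φ (x k) ≠ ζ k ∧
      ∑ j, a (0, j) * (φ (x j) - ζ j) = 0 ∧ ∑ j, a (1, j) * (φ (x j) - ζ j) = 0} := by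
  classical
  let y : Fin (m+1) → R := fun j => x j - algebraMap ℂ R (ζ j)
  let T := MvPolynomial (Fin 2 × {j : Fin (m+1) // j ≠ k}) R
  let w : Fin 2 × Fin (m+1) → T := fun ij =>
    if h : ij.2 = k then - ∑ j : {j : Fin (m+1) // j ≠ k}, C (y j) * X (ij.1, j)
    else C (y k) * X (ij.1, ⟨ij.2, h⟩)
  have hT : Algebra.trdeg ℂ T ≤ (2 * m + 1 : ℕ) := by
    have h := trdeg_add_eq ℂ R (A := T)
    rw [← h, MvPolynomial.trdeg_of_isDomain]
    have hc : Fintype.card (Fin 2 × {j : Fin (m+1) // j ≠ k}) = 2 * m := by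
      simp [Fintype.card_subtype_compl]
    rw [Cardinal.mk_fintype, hc]
    simp only [Cardinal.lift_natCast]
    push_cast
    rw [add_comm]
    gcongr
  have hdep : ¬ AlgebraicIndependent ℂ w := by
    intro h
    have h2 := (h.cardinalMk_le_trdeg).trans hT
    rw [Cardinal.mk_fintype] at h2
    simp only [Fintype.card_prod, Fintype.card_fin] at h2
    have := Nat.cast_le.1 h2
    omega
  rw [algebraicIndependent_iff] at hdep
  push Not at hdep
  obtain ⟨P, hP, hP0⟩ := hdep
  let ι : Fin 2 × Fin (m+1) → Fin (m+1) × Fin (m+1) := fun ij => (if ij.1 = 0 then 0 else 1, ij.2)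
  have h01 : (0 : Fin (m+1)) ≠ 1 := by
    obtain ⟨m, rfl⟩ : ∃ m', m = m' + 1 := ⟨m - 1, by omega⟩
    exact Fin.zero_ne_one
  have hι : Function.Injective ι := by
    rintro ⟨i, j⟩ ⟨i', j'⟩ h
    simp only [ι, Prod.mk.injEq] at h
    obtain ⟨h, rfl⟩ := h
    congr 1
    fin_cases i <;> fin_cases i' <;> simp_all
  refine ⟨rename ι P, fun h => hP0 (rename_injective ι hι (by simpa using h)), ?_⟩
  rintro a ⟨φ, hk, ha0, ha1⟩
  have hk' : φ (x k) - ζ k ≠ 0 := sub_ne_zero.2 hk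
  let ev : T →ₐ[ℂ] ℂ :=
    { eval₂Hom (φ : R →+* ℂ) (fun ij => a (ι (ij.1, ij.2)) / (φ (x k) - ζ k)) with
      commutes' := fun r => by
        simp [T, MvPolynomial.algebraMap_apply] }
  have hevC : ∀ r, ev (C r) = φ r := fun r => eval₂Hom_C _ _ _
  have hevX : ∀ ij, ev (X ij) = a (ι (ij.1, ij.2)) / (φ (x k) - ζ k) := fun ij => eval₂Hom_X' _ _ _
  have hy : ∀ j, φ (y j) = φ (x j) - ζ j := fun j => by simp [y]
  have haι : ∀ i, ∑ j, a (ι (i, j)) * (φ (x j) - ζ j) = 0 := by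
    intro i
    fin_cases i
    · simpa [ι] using ha0
    · simpa [ι] using ha1
  have hev : ∀ ij, ev (w ij) = a (ι ij) := by
    rintro ⟨i, j⟩
    by_cases h : j = k
    · subst h
      simp only [w, dif_pos, map_neg, map_sum, map_mul, hevC, hevX, hy]
      have h := haι i
      rw [Fintype.sum_eq_add_sum_subtype_ne _ j] at h
      have h3 : ∑ l : {l // l ≠ j}, (φ (x l) - ζ l) * (a (ι (i, l)) / (φ (x j) - ζ j))
          = (∑ l : {l // l ≠ j}, a (ι (i, l)) * (φ (x l) - ζ l)) / (φ (x j) - ζ j) := by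
        rw [Finset.sum_div]
        exact Finset.sum_congr rfl fun _ _ => by ring
      rw [h3]
      field_simp
      linear_combination -h
    · simp only [w, dif_neg h, map_mul, hevC, hevX, hy]
      field_simp
  have h := congrArg ev hP
  rw [map_zero, MvPolynomial.comp_aeval_apply] at h
  simp only [hev] at h
  rw [eval_rename, ← h, MvPolynomial.aeval_eq_eval]
  rfl

lemma exists_completion {m : ℕ} (J : Matrix (Fin m) (Fin (m+1)) ℂ) (h : ¬ J.rank < m) :
    ∃ j0 : Fin (m+1), ∀ M : Matrix (Fin (m+1)) (Fin (m+1)) ℂ,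
      (∀ j, M 0 j = if j = j0 then 1 else 0) → (∀ i j, M (Fin.succ i) j = J i j) → M.det ≠ 0 := by
  classical
  have hr : J.rank = m := le_antisymm (by simpa using J.rank_le_height) (not_lt.1 h)
  have hli : LinearIndependent ℂ J.row := by
    rw [linearIndependent_iff_card_eq_finrank_span, Set.finrank,
      ← Matrix.rank_eq_finrank_span_row, hr, Fintype.card_fin]
  obtain ⟨j0, hj0⟩ : ∃ j0 : Fin (m+1),
      (Pi.single j0 1 : Fin (m+1) → ℂ) ∉ Submodule.span ℂ (Set.range J.row) := by
    by_contra! hcon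
    have htop : Submodule.span ℂ (Set.range J.row) = ⊤ := by
      rw [eq_top_iff, ← (Pi.basisFun ℂ (Fin (m+1))).span_eq, Submodule.span_le]
      rintro _ ⟨j, rfl⟩
      simpa using hcon j
    have h2 := Matrix.rank_eq_finrank_span_row J
    rw [htop, hr, finrank_top] at h2
    simp at h2
  refine ⟨j0, fun M h0 h1 => ?_⟩
  have hM : M.row = Fin.cons (Pi.single j0 1) J.row := by
    funext i
    refine Fin.cases ?_ (fun i => ?_) i
    · funext j
      rw [Fin.cons_zero]
      simp [Matrix.row, h0, Pi.single_apply]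
    · funext j
      rw [Fin.cons_succ]
      simp [Matrix.row, h1]
  have hli2 : LinearIndependent ℂ M.row := by
    rw [hM]
    exact linearIndependent_finCons.2 ⟨hli, hj0⟩
  have := Matrix.linearIndependent_rows_iff_isUnit.1 hli2
  exact ((Matrix.isUnit_iff_isUnit_det M).1 this).ne_zero

theorem generic_projection_separates_finite_set
    (m : ℕ) (hm : 1 ≤ m)  -- n = m + 1 ≥ 2
    (f : Fin m → MvPolynomial (Fin (m + 1)) ℚ)
    -- the curve C ⊂ ℂⁿ
    (C : Set (Fin (m + 1) → ℂ))
    (hC : C = {z : Fin (m + 1) → ℂ | ∀ i, MvPolynomial.aeval z (f i) = 0})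
    -- the Jacobian matrix J_f(z)
    (J : (Fin (m + 1) → ℂ) → Matrix (Fin m) (Fin (m + 1)) ℂ)
    (hJ : J = fun z => Matrix.of fun i j =>
      MvPolynomial.aeval z (MvPolynomial.pderiv j (f i)))
    -- sing(C) is finite
    (hsing : Set.Finite {z ∈ C | (J z).rank < m})
    -- F is a finite subset of reg(C)
    (F : Set (Fin (m + 1) → ℂ)) (hFfin : Set.Finite F)
    (hF : F ⊆ C \ {z ∈ C | (J z).rank < m}) :
    ∃ Ψ : MvPolynomial (Fin (m + 1) × Fin (m + 1)) ℂ, Ψ ≠ 0 ∧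
      ∀ A : Matrix (Fin (m + 1)) (Fin (m + 1)) ℂ, IsUnit A.det →
        MvPolynomial.eval (fun ij => A ij.1 ij.2) Ψ ≠ 0 →
        ∀ ζ ∈ F, ∀ z ∈ C,
          A.mulVec z 0 = A.mulVec ζ 0 →
          A.mulVec z 1 = A.mulVec ζ 1 →
          z = ζ := by
  classical
  let g : Fin m → MvPolynomial (Fin (m+1)) ℂ := fun i => map (algebraMap ℚ ℂ) (f i)
  let I : Ideal (MvPolynomial (Fin (m+1)) ℂ) := Ideal.span (Set.range g)
  have hCg : ∀ z, z ∈ C ↔ ∀ i, eval z (g i) = 0 := by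
    intro z
    simp [hC, g, eval_map, aeval_def]
  have hJg : ∀ z i j, J z i j = eval z (pderiv j (g i)) := by
    intro z i j
    simp [hJ, g, pderiv_map, eval_map, aeval_def]
  let B₁ : (Fin (m+1) → ℂ) → (Fin (m+1) → ℂ) → Set (Fin (m+1) × Fin (m+1) → ℂ) :=
    fun ζ z => {a | z ≠ ζ ∧ ∑ j, a (0, j) * (z j - ζ j) = 0}
  let B₂ : (Fin (m+1) → ℂ) → Ideal (MvPolynomial (Fin (m+1)) ℂ) → Fin (m+1) →
      Set (Fin (m+1) × Fin (m+1) → ℂ) :=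
    fun ζ p k => {a | ∃ z, (∀ q ∈ p, eval z q = 0) ∧ ¬ (J z).rank < m ∧ z k ≠ ζ k ∧
      ∑ j, a (0, j) * (z j - ζ j) = 0 ∧ ∑ j, a (1, j) * (z j - ζ j) = 0}
  have hB₁ : ∀ ζ z, ThinSet (B₁ ζ z) := by
    intro ζ z
    by_cases hz : z = ζ
    · exact ⟨1, one_ne_zero, fun a ha => absurd hz ha.1⟩
    · obtain ⟨k, hk⟩ := Function.ne_iff.1 hz
      refine ⟨∑ j, X (0, j) * MvPolynomial.C (z j - ζ j), ?_, ?_⟩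
      · intro h
        have h2 := congrArg (eval (fun ij => if ij.2 = k then (1 : ℂ) else 0)) h
        simp [sub_eq_zero] at h2
        exact hk h2
      · intro a ha
        simpa using ha.2
  have hB₂ : ∀ ζ, ∀ p ∈ I.minimalPrimes, ∀ k, ThinSet (B₂ ζ p k) := by
    intro ζ p hp k
    by_cases hex : ∃ z, (∀ q ∈ p, eval z q = 0) ∧ ¬ (J z).rank < m
    swap
    · refine ⟨1, one_ne_zero, ?_⟩
      rintro a ⟨z, h1, h2, -⟩
      exact absurd ⟨z, h1, h2⟩ hex
    obtain ⟨z, hz, hzr⟩ := hex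
    have : p.IsPrime := hp.1.1
    obtain ⟨j0, hj0⟩ := exists_completion (J z) hzr
    let M : Matrix (Fin (m+1)) (Fin (m+1)) (MvPolynomial (Fin (m+1)) ℂ) :=
      Matrix.of (Fin.cons (fun j => if j = j0 then 1 else 0) (fun i j => pderiv j (g i)))
    have hM0 : ∀ j, M 0 j = if j = j0 then 1 else 0 := fun j => by simp [M]
    have hM1 : ∀ i j, M (Fin.succ i) j = pderiv j (g i) := fun i j => by simp [M]
    have hdet : M.det ∉ p := by
      intro h
      have h1 := hz _ h
      rw [RingHom.map_det] at h1
      refine hj0 _ ?_ ?_ h1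
      · intro j
        simp only [RingHom.mapMatrix_apply, Matrix.map_apply, hM0]
        split_ifs <;> simp
      · intro i j
        simp only [RingHom.mapMatrix_apply, Matrix.map_apply, hM1, hJg]
    have htr := trdeg_le_one _ (Ideal.Quotient.mkₐ ℂ p) (Ideal.Quotient.mkₐ_surjective ℂ p) g
      (fun i => Ideal.Quotient.eq_zero_iff_mem.2
        (hp.1.2 (Ideal.subset_span (Set.mem_range_self i)))) j0 M hM0 hM1
      (fun h => hdet (Ideal.Quotient.eq_zero_iff_mem.1 h))
    refine (thin_of_trdeg hm _ htr (fun j => Ideal.Quotient.mk p (X j)) k ζ).mono ?_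
    rintro a ⟨z, hz, -, hk, h0, h1⟩
    let φ : (MvPolynomial (Fin (m+1)) ℂ ⧸ p) →ₐ[ℂ] ℂ := Ideal.Quotient.liftₐ p (aeval z)
      (fun q hq => by simpa [aeval_eq_eval] using hz q hq)
    have hφ : ∀ j, φ (Ideal.Quotient.mk p (X j)) = z j := fun j => by
      simp [φ]
    refine ⟨φ, ?_, ?_, ?_⟩
    · simpa only [hφ] using hk
    · simpa only [hφ] using h0
    · simpa only [hφ] using h1
  obtain ⟨Ψ, hΨ0, hΨ⟩ := ThinSet.biUnion hFfin
    (fun ζ => (⋃ z ∈ {z ∈ C | (J z).rank < m}, B₁ ζ z) ∪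
      (⋃ p ∈ I.minimalPrimes, ⋃ k ∈ Set.univ, B₂ ζ p k))
    (fun ζ _ => (ThinSet.biUnion hsing _ fun z _ => hB₁ ζ z).union
      (ThinSet.biUnion (Ideal.finite_minimalPrimes_of_isNoetherianRing _ I) _ fun p hp =>
        ThinSet.biUnion Set.finite_univ _ fun k _ => hB₂ ζ p hp k))
  refine ⟨Ψ, hΨ0, fun A _ hA ζ hζ z hz h0 h1 => ?_⟩
  by_contra hne
  apply hA
  apply hΨ
  simp only [Set.mem_iUnion, Set.mem_union]
  have hrow : ∀ i, A.mulVec z i = A.mulVec ζ i → ∑ j, A i j * (z j - ζ j) = 0 := by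
    intro i h
    simp only [Matrix.mulVec, dotProduct] at h
    simp only [mul_sub, Finset.sum_sub_distrib, h, sub_self]
  refine ⟨ζ, hζ, ?_⟩
  by_cases hr : (J z).rank < m
  · exact Or.inl ⟨z, ⟨hz, hr⟩, hne, hrow 0 h0⟩
  · right
    have hmax : (RingHom.ker (eval z)).IsPrime := RingHom.ker_isPrime _
    have hI : I ≤ RingHom.ker (eval z) := by
      rw [Ideal.span_le]
      rintro _ ⟨i, rfl⟩
      exact (hCg z).1 hz i
    obtain ⟨p, hp, hpk⟩ := Ideal.exists_minimalPrimes_le hI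
    obtain ⟨k, hk⟩ := Function.ne_iff.1 hne
    exact ⟨p, hp, k, trivial, z, fun q hq => hpk hq, hr, hk, hrow 0 h0, hrow 1 h1⟩
end

section
/- Let n ≥ 1 and d ≥ 1 be integers. In the polynomial ring ℤ[ϑ₁,ϑ₂,ϑ₃], define Q = (d·ϑ₁)^{n−1} · (n(d−1)·ϑ₁ + ϑ₂ + ϑ₃)^{n} · (n(d−1)·ϑ₁ + ϑ₂) · (n(d−1)·ϑ₁ + ϑ₃). Then for every monomial ϑ₁^a ϑ₂^b ϑ₃^c with a ≤ n, b ≤ 1 and c ≤ n, the coefficient of ϑ₁^a ϑ₂^b ϑ₃^c in Q is zero unless (a,b,c) = (n,1,n), in which case this coefficient equals d^{n−1} · n(d−1) · (2n+1). Equivalently, the reduction of Q modulo the monomial ideal ⟨ϑ₁^{n+1}, ϑ₂², ϑ₃^{n+1}⟩ equals d^{n−1}·n(d−1)·(2n+1) · ϑ₁^{n} ϑ₂ ϑ₃^{n}. -/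
open MvPolynomial

lemma coeff_X_pow_mul_zero (i : Fin 3) (k : ℕ) (s : Fin 3 →₀ ℕ) (h : s i < k)
    (p : MvPolynomial (Fin 3) ℤ) : coeff s (X i ^ k * p) = 0 := by
  rw [X_pow_eq_monomial, coeff_monomial_mul', if_neg]
  intro hle
  have := hle i
  simp at this
  omega

lemma Q_expand {R : Type*} [CommRing R] (m : ℕ) (e D x y z : R) :
    ∃ A B E : R, (e * x) ^ m * (D * x + y + z) ^ (m + 1) * (D * x + y) * (D * x + z)
      = x ^ (m + 2) * A + y ^ 2 * B + z ^ (m + 2) * E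
        + e ^ m * D * (2 * (m + 1) + 1) * (x ^ (m + 1) * y * z ^ (m + 1)) := by
  obtain ⟨k, hk⟩ := Polynomial.powAddExpansion z (D * x + y) (m + 1)
  refine ⟨e ^ m * (D ^ 2 * z ^ (m + 1) + (m + 1) * (D ^ 2 * z ^ m * (D * x + z) + 2 * D ^ 2 * y * z ^ m)
      + k * (D ^ 3 * x + 3 * D ^ 2 * y) * (D * x + z)),
    e ^ m * x ^ m * ((m + 1) * z ^ m * (D * x + z) + k * (3 * D * x + y) * (D * x + z)),
    e ^ m * x ^ m * (D * x + y), ?_⟩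
  rw [add_comm (D * x + y) z, hk, mul_pow]
  simp only [Nat.add_sub_cancel]
  push_cast
  ring

theorem bezout_bound_coefficient (n d : ℕ) (hn : 1 ≤ n) (hd : 1 ≤ d) :
    ∀ a b c : ℕ, a ≤ n → b ≤ 1 → c ≤ n →
      MvPolynomial.coeff
        (Finsupp.single (0 : Fin 3) a + Finsupp.single (1 : Fin 3) b
          + Finsupp.single (2 : Fin 3) c)
        (((C (d : ℤ) * X (0 : Fin 3)) ^ (n - 1))
          * ((C ((n : ℤ) * ((d : ℤ) - 1)) * X (0 : Fin 3) + X 1 + X 2) ^ n)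
          * (C ((n : ℤ) * ((d : ℤ) - 1)) * X (0 : Fin 3) + X 1)
          * (C ((n : ℤ) * ((d : ℤ) - 1)) * X (0 : Fin 3) + X 2))
        = if (a, b, c) = (n, 1, n)
          then (d : ℤ) ^ (n - 1) * (n : ℤ) * ((d : ℤ) - 1) * (2 * (n : ℤ) + 1)
          else 0 := by
  intro a b c ha hb hc
  obtain ⟨m, rfl⟩ : ∃ m, n = m + 1 := ⟨n - 1, by omega⟩
  obtain ⟨A, B, E, h⟩ := Q_expand m (C (d : ℤ)) (C (((m + 1 : ℕ) : ℤ) * ((d : ℤ) - 1)))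
    (X (0 : Fin 3)) (X 1) (X 2)
  rw [Nat.add_sub_cancel, h, coeff_add, coeff_add, coeff_add,
    coeff_X_pow_mul_zero _ _ _ (by simp; omega), coeff_X_pow_mul_zero _ _ _ (by simp; omega),
    coeff_X_pow_mul_zero _ _ _ (by simp; omega)]
  have hC : (C (d : ℤ) ^ m * C (((m + 1 : ℕ) : ℤ) * ((d : ℤ) - 1)) * (2 * ((m : MvPolynomial (Fin 3) ℤ) + 1) + 1))
      = C ((d : ℤ) ^ m * ((m + 1 : ℕ) : ℤ) * ((d : ℤ) - 1) * (2 * ((m + 1 : ℕ) : ℤ) + 1)) := by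
    simp only [map_mul, map_add, map_pow, map_natCast, map_one, map_ofNat]
    push_cast
    ring
  have hM : (X 0 ^ (m + 1) * X 1 * X 2 ^ (m + 1) : MvPolynomial (Fin 3) ℤ)
      = monomial (Finsupp.single 0 (m + 1) + Finsupp.single 1 1 + Finsupp.single 2 (m + 1)) 1 := by
    rw [X_pow_eq_monomial, X_pow_eq_monomial, X, monomial_mul, monomial_mul]
    simp
  rw [hC, hM, coeff_C_mul, coeff_monomial]
  have hiff : (Finsupp.single (0 : Fin 3) (m + 1) + Finsupp.single 1 1 + Finsupp.single 2 (m + 1)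
      = Finsupp.single (0 : Fin 3) a + Finsupp.single 1 b + Finsupp.single 2 c)
      ↔ (a, b, c) = (m + 1, 1, m + 1) := by
    constructor
    · intro h
      have h0 := DFunLike.congr_fun h 0
      have h1 := DFunLike.congr_fun h 1
      have h2 := DFunLike.congr_fun h 2
      simp at h0 h1 h2
      rw [← h0, ← h1, ← h2]
    · intro h
      simp only [Prod.mk.injEq] at h
      obtain ⟨rfl, rfl, rfl⟩ := h
      rfl
  simp only [hiff]
  split_ifs <;> simp
end

section
/- There exists a constant κ > 0 such that for all integers n ≥ 1, d ≥ 2 and τ ≥ 1 the following holds. In ℤ[ζ,ϑ₁,ϑ₂,ϑ₃], define P₁ = (τζ + d·ϑ₁)^{n−1}, P₂ = (τζ + n(d−1)·ϑ₁ + ϑ₂ + ϑ₃)^{n}, P₃ = τζ + n(d−1)·ϑ₁ + ϑ₂, P₄ = τζ + n(d−1)·ϑ₁ + ϑ₃. Then the sum, over all exponent tuples (e,a,b,c) with e ≤ 1, a ≤ n, b ≤ 1 and c ≤ n, of the coefficients of ζ^e ϑ₁^a ϑ₂^b ϑ₃^c in the product P₁P₂P₃P₄ (equivalently, the sum of the coefficients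 of the reduction of P₁P₂P₃P₄ modulo ⟨ζ², ϑ₁^{n+1}, ϑ₂², ϑ₃^{n+1}⟩) is at most κ · (n⁵ d^{n+1} + τ n⁶ d^{n}). -/
open MvPolynomial

def NNCoeff (P : MvPolynomial (Fin 4) ℤ) : Prop := ∀ m, 0 ≤ coeff m P

theorem NNCoeff.add' {P Q : MvPolynomial (Fin 4) ℤ} (hP : NNCoeff P) (hQ : NNCoeff Q) :
    NNCoeff (P + Q) := fun m => by
  rw [coeff_add]; exact add_nonneg (hP m) (hQ m)

theorem NNCoeff.mul' {P Q : MvPolynomial (Fin 4) ℤ} (hP : NNCoeff P) (hQ : NNCoeff Q) :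
    NNCoeff (P * Q) := fun m => by
  rw [coeff_mul]; exact Finset.sum_nonneg fun x _ => mul_nonneg (hP _) (hQ _)

theorem NNCoeff.C' {a : ℤ} (ha : 0 ≤ a) : NNCoeff (C a) := fun m => by
  rw [coeff_C]; split_ifs <;> simp [ha]

theorem NNCoeff.X' (i : Fin 4) : NNCoeff (X i) := fun m => by
  classical
  rw [coeff_X]; split_ifs <;> simp

theorem NNCoeff.pow' {P : MvPolynomial (Fin 4) ℤ} (hP : NNCoeff P) (k : ℕ) :
    NNCoeff (P ^ k) := by
  induction k with
  | zero => simpa using NNCoeff.C' (a := 1) (by norm_num)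
  | succ k ih => rw [pow_succ]; exact ih.mul' hP

theorem NNCoeff.sum_le {P : MvPolynomial (Fin 4) ℤ} (hP : NNCoeff P) (x : Fin 4 → ℝ)
    (hx : ∀ i, 0 ≤ x i) (S : Finset (Fin 4 →₀ ℕ)) :
    ∑ m ∈ S, ((coeff m P : ℤ) : ℝ) * ∏ i, x i ^ m i ≤ eval₂ (Int.castRingHom ℝ) x P := by
  classical
  rw [eval₂_eq']
  have h0 : ∀ m, 0 ≤ ((coeff m P : ℤ) : ℝ) * ∏ i, x i ^ m i := fun m =>
    mul_nonneg (Int.cast_nonneg (hP m)) (Finset.prod_nonneg fun i _ => pow_nonneg (hx i) _)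
  calc _ ≤ ∑ m ∈ S ∪ P.support, ((coeff m P : ℤ) : ℝ) * ∏ i, x i ^ m i :=
        Finset.sum_le_sum_of_subset_of_nonneg Finset.subset_union_left fun m _ _ => h0 m
    _ = ∑ m ∈ P.support, ((coeff m P : ℤ) : ℝ) * ∏ i, x i ^ m i := by
        symm
        apply Finset.sum_subset Finset.subset_union_right
        intro m _ hm
        rw [notMem_support_iff.mp hm]; simp
    _ ≤ _ := by simp

theorem box_le {P : MvPolynomial (Fin 4) ℤ} (hP : NNCoeff P) (n : ℕ) (z t s : ℝ)
    (hz : 0 < z) (hz1 : z ≤ 1) (ht : 0 < t) (ht1 : t ≤ 1) (hs : 0 < s) (hs1 : s ≤ 1) :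
    ((∑ e ∈ Finset.range 2, ∑ a ∈ Finset.range (n + 1),
          ∑ b ∈ Finset.range 2, ∑ c ∈ Finset.range (n + 1),
            MvPolynomial.coeff
              (Finsupp.single (0 : Fin 4) e + Finsupp.single (1 : Fin 4) a
                + Finsupp.single (2 : Fin 4) b + Finsupp.single (3 : Fin 4) c) P : ℤ) : ℝ)
      * (z * t ^ n * s) ≤ eval₂ (Int.castRingHom ℝ) ![z, t, s, 1] P := by
  classical
  let f : ((ℕ × ℕ) × ℕ) × ℕ → (Fin 4 →₀ ℕ) := fun p =>
    Finsupp.single (0 : Fin 4) p.1.1.1 + Finsupp.single (1 : Fin 4) p.1.1.2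
                + Finsupp.single (2 : Fin 4) p.1.2 + Finsupp.single (3 : Fin 4) p.2
  have f0 : ∀ p, f p 0 = p.1.1.1 := fun p => by simp [f]
  have f1 : ∀ p, f p 1 = p.1.1.2 := fun p => by simp [f]
  have f2 : ∀ p, f p 2 = p.1.2 := fun p => by simp [f]
  have f3 : ∀ p, f p 3 = p.2 := fun p => by simp [f]
  have hf : Function.Injective f := by
    rintro p q h
    have h0 := f0 p; have h1 := f1 p; have h2 := f2 p; have h3 := f3 p
    rw [h] at h0 h1 h2 h3
    rw [f0] at h0; rw [f1] at h1; rw [f2] at h2; rw [f3] at h3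
    ext <;> simp_all
  let B := ((Finset.range 2 ×ˢ Finset.range (n+1)) ×ˢ Finset.range 2) ×ˢ Finset.range (n+1)
  have hB : (∑ e ∈ Finset.range 2, ∑ a ∈ Finset.range (n + 1),
          ∑ b ∈ Finset.range 2, ∑ c ∈ Finset.range (n + 1),
            MvPolynomial.coeff
              (Finsupp.single (0 : Fin 4) e + Finsupp.single (1 : Fin 4) a
                + Finsupp.single (2 : Fin 4) b + Finsupp.single (3 : Fin 4) c) P : ℤ)
      = ∑ p ∈ B, coeff (f p) P := by
    simp only [B, Finset.sum_product, f]
  rw [hB]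
  have hx : ∀ i, 0 ≤ (![z, t, s, 1] : Fin 4 → ℝ) i := by
    intro i; fin_cases i <;> simp [hz.le, ht.le, hs.le]
  refine le_trans ?_ (hP.sum_le ![z, t, s, 1] hx (B.image f))
  rw [Finset.sum_image (fun _ _ _ _ h => hf h)]
  push_cast
  rw [Finset.sum_mul]
  refine Finset.sum_le_sum fun p hp => ?_
  refine mul_le_mul_of_nonneg_left ?_ (Int.cast_nonneg (hP (f p)))
  simp only [B, Finset.mem_product, Finset.mem_range] at hp
  obtain ⟨⟨⟨he, ha⟩, hb⟩, hc⟩ := hp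
  rw [Fin.prod_univ_four, f0, f1, f2, f3]
  simp only [Matrix.cons_val, one_pow, mul_one]
  have e1 : z ≤ z ^ p.1.1.1 := by
    simpa using pow_le_pow_of_le_one hz.le hz1 (show p.1.1.1 ≤ 1 by omega)
  have e2 : t ^ n ≤ t ^ p.1.1.2 := pow_le_pow_of_le_one ht.le ht1 (by omega)
  have e3 : s ≤ s ^ p.1.2 := by
    simpa using pow_le_pow_of_le_one hs.le hs1 (show p.1.2 ≤ 1 by omega)
  gcongr

theorem height_bound_truncated_coefficient_sum :
    ∃ κ : ℝ, 0 < κ ∧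
      ∀ n d τ : ℕ, 1 ≤ n → 2 ≤ d → 1 ≤ τ →
        ((∑ e ∈ Finset.range 2, ∑ a ∈ Finset.range (n + 1),
          ∑ b ∈ Finset.range 2, ∑ c ∈ Finset.range (n + 1),
            MvPolynomial.coeff
              (Finsupp.single (0 : Fin 4) e + Finsupp.single (1 : Fin 4) a
                + Finsupp.single (2 : Fin 4) b + Finsupp.single (3 : Fin 4) c)
              (((C (τ : ℤ) * X (0 : Fin 4) + C (d : ℤ) * X 1) ^ (n - 1))
                * ((C (τ : ℤ) * X (0 : Fin 4)
                    + C ((n : ℤ) * ((d : ℤ) - 1)) * X 1 + X 2 + X 3) ^ n)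
                * (C (τ : ℤ) * X (0 : Fin 4)
                    + C ((n : ℤ) * ((d : ℤ) - 1)) * X 1 + X 2)
                * (C (τ : ℤ) * X (0 : Fin 4)
                    + C ((n : ℤ) * ((d : ℤ) - 1)) * X 1 + X 3)) : ℤ) : ℝ)
          ≤ κ * ((n : ℝ) ^ 5 * (d : ℝ) ^ (n + 1) + (τ : ℝ) * (n : ℝ) ^ 6 * (d : ℝ) ^ n) := by
  refine ⟨9 * Real.exp 4, by positivity, ?_⟩
  intro n d τ hn hd hτ
  have hN : (0 : ℤ) ≤ (n : ℤ) * ((d : ℤ) - 1) := by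
    apply mul_nonneg <;> omega
  have hA : NNCoeff (C (τ : ℤ) * X (0 : Fin 4)) :=
    (NNCoeff.C' (by positivity)).mul' (NNCoeff.X' 0)
  have hD : NNCoeff (C (d : ℤ) * X (1 : Fin 4)) :=
    (NNCoeff.C' (by positivity)).mul' (NNCoeff.X' 1)
  have hE : NNCoeff (C ((n : ℤ) * ((d : ℤ) - 1)) * X (1 : Fin 4)) :=
    (NNCoeff.C' hN).mul' (NNCoeff.X' 1)
  have hP := ((((hA.add' hD).pow' (n - 1)).mul'
    ((((hA.add' hE).add' (NNCoeff.X' 2)).add' (NNCoeff.X' 3)).pow' n)).mul'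
    ((hA.add' hE).add' (NNCoeff.X' 2))).mul' ((hA.add' hE).add' (NNCoeff.X' 3))
  have hn' : (1 : ℝ) ≤ n := by exact_mod_cast hn
  have hd' : (2 : ℝ) ≤ d := by exact_mod_cast hd
  have hτ' : (1 : ℝ) ≤ τ := by exact_mod_cast hτ
  have hn0 : (0 : ℝ) < n := by linarith
  have hd0 : (0 : ℝ) < d := by linarith
  have hτ0 : (0 : ℝ) < τ := by linarith
  have key := box_le hP n (1 / (τ * n ^ 3)) (1 / (n ^ 2 * d)) (1 / n) (by positivity)
    (by
      rw [div_le_one (by positivity)]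
      exact one_le_mul_of_one_le_of_one_le hτ' (one_le_pow₀ hn')) (by positivity)
    (by
      rw [div_le_one (by positivity)]
      exact one_le_mul_of_one_le_of_one_le (one_le_pow₀ hn') (by linarith)) (by positivity)
    (by rw [div_le_one (by positivity)]; exact hn')
  generalize hS : (∑ e ∈ Finset.range 2, ∑ a ∈ Finset.range (n + 1),
          ∑ b ∈ Finset.range 2, ∑ c ∈ Finset.range (n + 1), _ : ℤ) = S at key ⊢
  simp only [eval₂_mul, eval₂_pow, eval₂_add, eval₂_C, eval₂_X, Matrix.cons_val,
    Int.coe_castRingHom, Int.cast_mul, Int.cast_sub, Int.cast_natCast, Int.cast_one] at key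
  have a1 : (τ : ℝ) * (1 / (τ * n ^ 3)) = 1 / n ^ 3 := by field_simp
  have a2 : (d : ℝ) * (1 / (n ^ 2 * d)) = 1 / n ^ 2 := by field_simp
  have a3 : (n : ℝ) * (d - 1) * (1 / (n ^ 2 * d)) ≤ 1 / n := by
    rw [mul_one_div, div_le_div_iff₀ (by positivity) hn0]
    nlinarith [pow_pos hn0 2]
  have a3' : 0 ≤ (n : ℝ) * (d - 1) * (1 / (n ^ 2 * d)) :=
    mul_nonneg (mul_nonneg hn0.le (by linarith)) (by positivity)
  have a4 : (1 : ℝ) / n ^ 3 ≤ 1 / n :=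
    one_div_le_one_div_of_le hn0 (le_self_pow₀ hn' (by norm_num))
  have a5 : (1 : ℝ) / n ≤ 1 := by rw [div_le_one hn0]; exact hn'
  have a6 : (0 : ℝ) < 1 / n ^ 3 := by positivity
  have a7 : (0 : ℝ) < 1 / n := by positivity
  rw [a1, a2] at key
  generalize (n : ℝ) * (d - 1) * (1 / (n ^ 2 * d)) = u at key a3 a3'
  have b1 : ((1 : ℝ) / n ^ 3 + 1 / n ^ 2) ^ (n - 1) ≤ (1 / n ^ 2) ^ (n - 1) * Real.exp 1 := by
    have : (1 : ℝ) / n ^ 3 + 1 / n ^ 2 = 1 / n ^ 2 * (1 / n + 1) := by field_simp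
    rw [this, mul_pow]
    gcongr
    calc ((1 : ℝ) / n + 1) ^ (n - 1) ≤ (1 / n + 1) ^ n :=
          pow_le_pow_right₀ (by linarith) (by omega)
      _ ≤ Real.exp (1 / n) ^ n := by gcongr; exact Real.add_one_le_exp _
      _ = Real.exp 1 := by rw [← Real.exp_nat_mul]; congr 1; field_simp
  have b2 : ((1 : ℝ) / n ^ 3 + u + 1 / n + 1) ^ n ≤ Real.exp 3 := by
    calc ((1 : ℝ) / n ^ 3 + u + 1 / n + 1) ^ n ≤ Real.exp (3 / n) ^ n := by
          gcongr
          refine le_trans ?_ (Real.add_one_le_exp _)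
          have : (3 : ℝ) / n = 1 / n + 1 / n + 1 / n := by ring
          linarith
      _ = Real.exp 3 := by rw [← Real.exp_nat_mul]; congr 1; field_simp
  have b3 : (1 : ℝ) / n ^ 3 + u + 1 / n ≤ 3 * (1 / n) := by linarith
  have b4 : (1 : ℝ) / n ^ 3 + u + 1 ≤ 3 := by linarith
  have key2 : (S : ℝ) * (1 / (τ * n ^ 3) * (1 / (n ^ 2 * d)) ^ n * (1 / n)) ≤
      (1 / n ^ 2) ^ (n - 1) * Real.exp 1 * Real.exp 3 * (3 * (1 / n)) * 3 :=
    key.trans (by gcongr)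
  have ee : Real.exp 4 = Real.exp 1 * Real.exp 3 := by rw [← Real.exp_add]; norm_num
  have hfin : (S : ℝ) ≤ 9 * Real.exp 4 * (τ * n ^ 5 * d ^ n) := by
    have hw : (0 : ℝ) < 1 / (τ * n ^ 3) * (1 / (n ^ 2 * d)) ^ n * (1 / n) := by positivity
    refine le_of_mul_le_mul_right (key2.trans (le_of_eq ?_)) hw
    rw [ee]
    obtain ⟨k, rfl⟩ : ∃ k, n = k + 1 := ⟨n - 1, by omega⟩
    simp only [Nat.add_sub_cancel, div_pow, mul_pow, one_pow]
    generalize ((k + 1 : ℕ) : ℝ) = y at hn0 ⊢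
    rw [pow_succ (y ^ 2) k]
    field_simp
    norm_num
  refine hfin.trans ?_
  refine mul_le_mul_of_nonneg_left ?_ (by positivity)
  have c1 : (τ : ℝ) * n ^ 5 * d ^ n ≤ τ * n ^ 6 * d ^ n := by
    gcongr
    · norm_num
  have c2 : (0 : ℝ) ≤ n ^ 5 * d ^ (n + 1) := by positivity
  linarith
end

section
/- Let n ≥ 2, let f₁,…,f_{n−1} ∈ ℚ[x₁,…,xₙ], and let J be the (n−1)×n matrix of polynomials whose (i,j) entry is ∂f_i/∂x_j. Fix j₀ ∈ {1,…,n} and let Δ ∈ ℚ[x₁,…,xₙ] be the determinant of the (n−1)×(n−1) submatrix of J obtained by deleting column j₀. Let z ∈ ℂⁿ and t ∈ ℂ be such that f_i(z) = 0 for all i ∈ {1,…,n−1} and t·Δ(z) = 1. Then the n×(n+1) complex matrix M, whose i-th row for 1 ≤ i ≤ n−1 is (∂f_i/∂x_1(z), …, ∂f_i/∂x_n(z), 0) and whose n-th row is (t·∂Δ/∂x_1(z), …, t·∂Δ/∂x_n(z), Δ(z)), has rank n. (This matrix is the Jacobian, with respect to (x₁,…,xₙ,T), of the system f₁ = ⋯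 = f_{n−1} = TΔ − 1 = 0, evaluated at (z,t).) -/
theorem jacobian_of_saturated_system_full_rank
    (m : ℕ) (hm : 1 ≤ m)  -- n = m + 1 ≥ 2
    (f : Fin m → MvPolynomial (Fin (m + 1)) ℚ)
    (j₀ : Fin (m + 1))
    -- Δ : determinant of the (n-1)×(n-1) submatrix of the Jacobian obtained by
    -- deleting column j₀
    (Δ : MvPolynomial (Fin (m + 1)) ℚ)
    (hΔ : Δ = Matrix.det (Matrix.of fun (i j : Fin m) =>
      MvPolynomial.pderiv (j₀.succAbove j) (f i)))
    (z : Fin (m + 1) → ℂ) (t : ℂ)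
    (hz : ∀ i, MvPolynomial.aeval z (f i) = 0)
    (ht : t * MvPolynomial.aeval z Δ = 1)
    -- M : the Jacobian, with respect to (x₁,…,xₙ,T), of the system
    -- f₁ = ⋯ = f_{n-1} = TΔ - 1 = 0, evaluated at (z, t)
    (M : Matrix (Fin (m + 1)) (Fin (m + 2)) ℂ)
    (hM : ∀ (i : Fin (m + 1)) (j : Fin (m + 2)),
      M i j =
        if hi : (i : ℕ) < m then
          -- rows 1 ≤ i ≤ n-1 : (∂f_i/∂x₁(z), …, ∂f_i/∂xₙ(z), 0)
          (if hj : (j : ℕ) < m + 1 then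
              MvPolynomial.aeval z (MvPolynomial.pderiv (⟨j, hj⟩ : Fin (m + 1)) (f ⟨i, hi⟩))
            else 0)
        else
          -- last row : (t·∂Δ/∂x₁(z), …, t·∂Δ/∂xₙ(z), Δ(z))
          (if hj : (j : ℕ) < m + 1 then
              t * MvPolynomial.aeval z (MvPolynomial.pderiv (⟨j, hj⟩ : Fin (m + 1)) Δ)
            else MvPolynomial.aeval z Δ)) :
    M.rank = m + 1 := by
  have hD : MvPolynomial.aeval z Δ ≠ 0 := right_ne_zero_of_mul_eq_one ht
  have hdet : (Matrix.of fun (i j : Fin m) =>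
      (MvPolynomial.aeval z (MvPolynomial.pderiv (j₀.succAbove j) (f i)) : ℂ)).det ≠ 0 := by
    intro h
    apply hD
    rw [hΔ, AlgHom.map_det, ← h]
    rfl
  have hli : LinearIndependent ℂ M.row := by
    rw [Fintype.linearIndependent_iff]
    intro g hg
    have hcol : ∀ j, ∑ i : Fin m, g i.castSucc * M i.castSucc j
        + g (Fin.last m) * M (Fin.last m) j = 0 := by
      intro j
      have h := congrFun hg j
      simpa [Finset.sum_apply, Fin.sum_univ_castSucc] using h
    have hlast : g (Fin.last m) = 0 := by
      have h := hcol (Fin.last (m + 1))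
      simpa [hM, hD] using h
    have hv : (fun i : Fin m => g i.castSucc) = 0 := by
      apply Matrix.eq_zero_of_vecMul_eq_zero hdet
      funext j
      have h := hcol (j₀.succAbove j).castSucc
      have hle : ((j₀.succAbove j : Fin (m + 1)) : ℕ) ≤ m := Nat.lt_succ_iff.mp (j₀.succAbove j).isLt
      simpa [hM, hlast, hle, Matrix.vecMul, dotProduct] using h
    intro i
    induction i using Fin.lastCases with
    | last => exact hlast
    | cast i => exact congrFun hv i
  simpa using hli.rank_matrix
end
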